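/- Let 0 < α ≤ 1/2. Every properly edge-coloured complete graph K_n in which at least n − αn/150 colours are α-rich contains at least α²n/10^6 pairwise edge-disjoint rainbow spanning trees. -/

import Mathlib

open scoped Classical

/-- A colouring of edges is proper if edges sharing a vertex get distinct colours. -/
def ProperColoring {V : Type*} (G : SimpleGraph V) (c : Sym2 V → ℕ) : Prop :=
  ∀ ⦃a b b' : V⦄, G.Adj a b → G.Adj a b' → b ≠ b' → c s(a, b) ≠ c s(a, b')

/-- A set of edges is rainbow if its edges have pairwise distinct colours. -/
def IsRainbow {V : Type*} (c : Sym2 V → ℕ) (E : Set (Sym2 V)) : Prop :=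
  Set.InjOn c E

/-- A finite set of edges forms a matching: non-loops, pairwise vertex-disjoint. -/
def IsMatchingSet {V : Type*} (M : Finset (Sym2 V)) : Prop :=
  (∀ e ∈ M, ¬ e.IsDiag) ∧
  ∀ e ∈ M, ∀ f ∈ M, e ≠ f → ∀ v : V, v ∈ e → v ∉ f

/-- A class `U` of colours is `α`-rich in `G`: the edges of `G` with colour in `U`
contain a matching of size at least `α * |V|`. -/
def RichClass {V : Type*} [Fintype V] (G : SimpleGraph V) (c : Sym2 V → ℕ)
    (α : ℝ) (U : Set ℕ) : Prop :=
  ∃ M : Finset (Sym2 V), ↑M ⊆ G.edgeSet ∧ (∀ e ∈ M, c e ∈ U) ∧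
    IsMatchingSet M ∧ α * (Fintype.card V : ℝ) ≤ (M.card : ℝ)

/-- `G` is `α`-well-coloured: its colours can be partitioned into `|V| - 1`
pairwise disjoint `α`-rich classes. -/
def WellColoured {V : Type*} [Fintype V] (G : SimpleGraph V) (c : Sym2 V → ℕ)
    (α : ℝ) : Prop :=
  ∃ U : Fin (Fintype.card V - 1) → Set ℕ,
    (∀ i j, i ≠ j → Disjoint (U i) (U j)) ∧
    (∀ i, RichClass G c α (U i)) ∧
    (∀ e ∈ G.edgeSet, ∃ i, c e ∈ U i)

/-- A rainbow forest in `G`. -/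
def RainbowForest {V : Type*} (G : SimpleGraph V) (c : Sym2 V → ℕ)
    (F : SimpleGraph V) : Prop :=
  F ≤ G ∧ F.IsAcyclic ∧ IsRainbow c F.edgeSet

/-- `G` is `(α, t)`-robustly-coloured: after removing the edges of any `t`
rainbow forests, `G` remains `α`-well-coloured. -/
def RobustlyColoured {V : Type*} [Fintype V] (G : SimpleGraph V) (c : Sym2 V → ℕ)
    (α : ℝ) (t : ℕ) : Prop :=
  ∀ F : Fin t → SimpleGraph V, (∀ i, RainbowForest G c (F i)) →
    WellColoured (G.deleteEdges (⋃ i, (F i).edgeSet)) c α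

/-- The rank axioms of a matroid, for a function on finite sets. -/
structure IsRank {β : Type*} [DecidableEq β] (r : Finset β → ℕ) : Prop where
  empty : r ∅ = 0
  mono : ∀ {A B : Finset β}, A ⊆ B → r A ≤ r B
  insert_le : ∀ (x : β) (A : Finset β), r (insert x A) ≤ r A + 1
  submod : ∀ A B : Finset β, r (A ∪ B) + r (A ∩ B) ≤ r A + r B

namespace IsRank

variable {β : Type*} [DecidableEq β] {r : Finset β → ℕ}

lemma insert_le_add (h : IsRank r) (x : β) (A : Finset β) : r (insert x A) ≤ r A + r {x} := by
  have := h.submod A {x}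
  rw [Finset.union_comm, ← Finset.insert_eq] at this
  omega

lemma union_le_add_card (h : IsRank r) (A B : Finset β) : r (A ∪ B) ≤ r A + B.card := by
  induction B using Finset.induction_on with
  | empty => simp
  | insert x B hx ih =>
    rw [Finset.union_insert, Finset.card_insert_of_notMem hx]
    have := h.insert_le x (A ∪ B)
    omega

lemma contract (h : IsRank r) {x : β} (hx : r {x} = 1) :
    IsRank fun A => r (insert x A) - 1 := by
  have pos : ∀ A, 1 ≤ r (insert x A) := fun A => by
    rw [← hx]; exact h.mono (by simp)
  refine ⟨by simp [hx], fun hAB => ?_, fun y A => ?_, fun A B => ?_⟩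
  · exact Nat.sub_le_sub_right (h.mono (Finset.insert_subset_insert x hAB)) 1
  · have h1 := h.insert_le y (insert x A)
    rw [Finset.insert_comm] at h1
    have := pos A
    omega
  · have h1 := h.submod (insert x A) (insert x B)
    rw [← Finset.insert_inter_distrib, ← Finset.insert_union_distrib] at h1
    have := pos A
    have := pos B
    have := pos (A ∩ B)
    have := pos (A ∪ B)
    omega

end IsRank

/-- Edmonds' matroid intersection theorem, in terms of rank functions. -/
theorem exists_common_independent {β : Type*} [DecidableEq β] (E : Finset β) :
    ∀ {r₁ r₂ : Finset β → ℕ}, IsRank r₁ → IsRank r₂ → ∀ k : ℕ,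
      (∀ A ⊆ E, k ≤ r₁ A + r₂ (E \ A)) →
      ∃ I ⊆ E, I.card = k ∧ r₁ I = k ∧ r₂ I = k := by
  induction E using Finset.induction_on with
  | empty =>
    intro r₁ r₂ h₁ h₂ k hk
    have := hk ∅ (by simp)
    simp only [Finset.sdiff_empty, h₁.empty, h₂.empty] at this
    exact ⟨∅, by simp, by simp; omega, by rw [h₁.empty]; omega, by rw [h₂.empty]; omega⟩
  | insert e E he ih =>
    intro r₁ r₂ h₁ h₂ k hk
    by_cases hdel : ∀ A ⊆ E, k ≤ r₁ A + r₂ (E \ A)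
    · obtain ⟨I, hI, h⟩ := ih h₁ h₂ k hdel
      exact ⟨I, hI.trans (Finset.subset_insert _ _), h⟩
    push Not at hdel
    obtain ⟨A, hAE, hA⟩ := hdel
    have heA : e ∉ A := fun h => he (hAE h)
    have e₁ : insert e E \ insert e A = E \ A := by
      ext y; simp only [Finset.mem_sdiff, Finset.mem_insert]; grind
    have e₂ : insert e E \ A = insert e (E \ A) := by
      ext y; simp only [Finset.mem_sdiff, Finset.mem_insert]; grind
    have one₁ : r₁ {e} = 1 := by
      have a := h₁.insert_le_add e A
      have b := hk (insert e A) (Finset.insert_subset_insert e hAE)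
      have d := h₁.insert_le e ∅
      rw [e₁] at b
      simp only [insert_empty_eq, h₁.empty] at d
      omega
    have one₂ : r₂ {e} = 1 := by
      have a := h₂.insert_le_add e (E \ A)
      have b := hk A (hAE.trans (Finset.subset_insert _ _))
      have d := h₂.insert_le e ∅
      rw [e₂] at b
      simp only [insert_empty_eq, h₂.empty] at d
      omega
    have pos₁ : ∀ A, 1 ≤ r₁ (insert e A) := fun A => by
      rw [← one₁]; exact h₁.mono (by simp)
    have pos₂ : ∀ A, 1 ≤ r₂ (insert e A) := fun A => by
      rw [← one₂]; exact h₂.mono (by simp)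
    obtain ⟨I, hIE, hIc, hI₁, hI₂⟩ := ih (h₁.contract one₁) (h₂.contract one₂) (k - 1) (by
      intro B hBE
      by_contra hcon
      have s₁ := h₁.submod A (insert e B)
      have s₂ := h₂.submod (E \ A) (insert e (E \ B))
      have t₁ : A ∩ insert e B = A ∩ B := by
        ext y; simp only [Finset.mem_inter, Finset.mem_insert]; grind
      have t₂ : A ∪ insert e B = insert e (A ∪ B) := by simp
      have t₃ : (E \ A) ∩ insert e (E \ B) = insert e E \ insert e (A ∪ B) := by
        ext y; simp only [Finset.mem_inter, Finset.mem_insert, Finset.mem_sdiff,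
          Finset.mem_union]; grind
      have t₄ : (E \ A) ∪ insert e (E \ B) = insert e E \ (A ∩ B) := by
        ext y; simp only [Finset.mem_inter, Finset.mem_insert, Finset.mem_sdiff,
          Finset.mem_union]; grind
      rw [t₁, t₂] at s₁
      rw [t₃, t₄] at s₂
      have k₁ := hk (insert e (A ∪ B))
        (Finset.insert_subset_insert e (Finset.union_subset hAE hBE))
      have k₂ := hk (A ∩ B) ((Finset.inter_subset_left.trans hAE).trans
        (Finset.subset_insert _ _))
      have := pos₁ B
      have := pos₂ (E \ B)
      omega)
    have heI : e ∉ I := fun h => he (hIE h)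
    have := pos₁ I
    have := pos₂ I
    refine ⟨insert e I, Finset.insert_subset_insert e hIE, ?_, ?_, ?_⟩
    · rw [Finset.card_insert_of_notMem heI]; omega
    · omega
    · omega

/-- The number of colours in `X`, where at most `d` of the colours in `Φ` are counted. -/
noncomputable def cappedColours {β : Type*} (c : β → ℕ) (Φ : Finset ℕ) (d : ℕ)
    (X : Finset β) : ℕ :=
  (X.image c \ Φ).card + min d (X.image c ∩ Φ).card

lemma isRank_cappedColours {β : Type*} [DecidableEq β] (c : β → ℕ) (Φ : Finset ℕ) (d : ℕ) :
    IsRank (cappedColours c Φ d) := by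
  have mono₁ : ∀ {A B : Finset β}, A ⊆ B → (A.image c \ Φ).card ≤ (B.image c \ Φ).card :=
    fun h => Finset.card_le_card (Finset.sdiff_subset_sdiff (Finset.image_subset_image h) le_rfl)
  have mono₂ : ∀ {A B : Finset β}, A ⊆ B → (A.image c ∩ Φ).card ≤ (B.image c ∩ Φ).card :=
    fun h => Finset.card_le_card (Finset.inter_subset_inter (Finset.image_subset_image h) le_rfl)
  refine ⟨by simp [cappedColours], fun h => ?_, fun x A => ?_, fun A B => ?_⟩
  · have := mono₁ h
    have := mono₂ h
    unfold cappedColours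
    omega
  · unfold cappedColours
    rw [Finset.image_insert]
    by_cases hx : c x ∈ Φ
    · rw [Finset.insert_sdiff_of_mem _ hx, Finset.insert_inter_of_mem hx]
      have := Finset.card_insert_le (c x) (A.image c ∩ Φ)
      omega
    · rw [Finset.insert_sdiff_of_notMem _ hx, Finset.insert_inter_of_notMem hx]
      have := Finset.card_insert_le (c x) (A.image c \ Φ)
      omega
  · have h₁ : ((A ∪ B).image c \ Φ).card + ((A ∩ B).image c \ Φ).card
        ≤ (A.image c \ Φ).card + (B.image c \ Φ).card := by
      rw [← Finset.card_union_add_card_inter (A.image c \ Φ), Finset.image_union,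
        Finset.union_sdiff_distrib]
      refine Nat.add_le_add_left (Finset.card_le_card ?_) _
      intro y hy
      simp only [Finset.mem_sdiff, Finset.mem_image, Finset.mem_inter] at hy ⊢
      grind
    have h₂ : ((A ∪ B).image c ∩ Φ).card + ((A ∩ B).image c ∩ Φ).card
        ≤ (A.image c ∩ Φ).card + (B.image c ∩ Φ).card := by
      rw [← Finset.card_union_add_card_inter (A.image c ∩ Φ), Finset.image_union,
        Finset.union_inter_distrib_right]
      refine Nat.add_le_add_left (Finset.card_le_card ?_) _
      intro y hy
      simp only [Finset.mem_image, Finset.mem_inter] at hy ⊢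
      grind
    have a₁ := mono₂ (Finset.subset_union_left (s₁ := A) (s₂ := B))
    have a₂ := mono₂ (Finset.subset_union_right (s₁ := A) (s₂ := B))
    have a₃ := mono₂ (Finset.inter_subset_left (s₁ := A) (s₂ := B))
    have a₄ := mono₂ (Finset.inter_subset_right (s₁ := A) (s₂ := B))
    unfold cappedColours
    omega

section GraphRank

variable {V : Type*}

/-- The functions on the vertices that agree on the two ends of every edge of `A`. -/
def constOn (A : Finset (Sym2 V)) : Submodule ℚ (V → ℚ) where
  carrier := {f | ∀ u v, s(u, v) ∈ A → f u = f v}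
  add_mem' := fun hf hg u v h => by simp [hf u v h, hg u v h]
  zero_mem' := fun _ _ _ => rfl
  smul_mem' := fun a f hf u v h => by simp [hf u v h]

lemma constOn_anti {A B : Finset (Sym2 V)} (h : A ⊆ B) : constOn B ≤ constOn A :=
  fun _ hf u v he => hf u v (h he)

variable [Fintype V]

/-- The rank of a set of edges in the cycle matroid of the complete graph. -/
noncomputable def graphRank (A : Finset (Sym2 V)) : ℕ :=
  Fintype.card V - Module.finrank ℚ (constOn A)

lemma finrank_constOn_le (A : Finset (Sym2 V)) :
    Module.finrank ℚ (constOn A) ≤ Fintype.card V := by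
  simpa using Submodule.finrank_le (constOn A)

lemma isRank_graphRank : IsRank (graphRank (V := V)) := by
  refine ⟨?_, fun h => ?_, fun e A => ?_, fun A B => ?_⟩
  · have : constOn (∅ : Finset (Sym2 V)) = ⊤ := by
      ext f; simp [constOn]
    unfold graphRank
    rw [this]
    simp
  · exact Nat.sub_le_sub_left (Submodule.finrank_mono (constOn_anti h)) _
  · obtain ⟨a, b⟩ := e
    change graphRank (insert s(a, b) A) ≤ _
    let φ : (V → ℚ) →ₗ[ℚ] ℚ :=
      LinearMap.proj (R := ℚ) (φ := fun _ => ℚ) a - LinearMap.proj (R := ℚ) (φ := fun _ => ℚ) b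
    have h₁ : constOn A ⊓ LinearMap.ker φ ≤ constOn (insert s(a, b) A) := by
      rintro f ⟨hf, hk⟩ u v he
      have hk : f a = f b := by
        have : φ f = 0 := hk
        simpa [φ, sub_eq_zero] using this
      rcases Finset.mem_insert.1 he with h | h
      · rcases Sym2.eq_iff.1 h with ⟨rfl, rfl⟩ | ⟨rfl, rfl⟩
        · exact hk
        · exact hk.symm
      · exact hf u v h
    have h₂ := Submodule.finrank_mono h₁
    have h₃ := Submodule.finrank_sup_add_finrank_inf_eq (constOn A) (LinearMap.ker φ)
    have h₄ := LinearMap.finrank_range_add_finrank_ker φ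
    have h₅ : Module.finrank ℚ (LinearMap.range φ) ≤ 1 := by
      simpa using Submodule.finrank_le (LinearMap.range φ)
    have h₆ := Submodule.finrank_le (constOn A ⊔ LinearMap.ker φ)
    have h₇ := finrank_constOn_le A
    simp only [Module.finrank_fintype_fun_eq_card] at h₄ h₆
    unfold graphRank
    omega
  · have h₁ : constOn (A ∪ B) = constOn A ⊓ constOn B := by
      ext f
      constructor
      · intro hf
        exact ⟨fun u v h => hf u v (Finset.mem_union_left _ h),
          fun u v h => hf u v (Finset.mem_union_right _ h)⟩
      · rintro ⟨hA, hB⟩ u v h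
        rcases Finset.mem_union.1 h with h | h
        · exact hA u v h
        · exact hB u v h
    have h₂ := Submodule.finrank_mono (sup_le (constOn_anti (Finset.inter_subset_left (s₁ := A)
      (s₂ := B))) (constOn_anti (Finset.inter_subset_right (s₁ := A) (s₂ := B))))
    have h₃ := Submodule.finrank_sup_add_finrank_inf_eq (constOn A) (constOn B)
    have := finrank_constOn_le A
    have := finrank_constOn_le B
    have := finrank_constOn_le (A ∩ B)
    have := finrank_constOn_le (A ∪ B)
    unfold graphRank
    rw [← h₁] at h₃
    omega

lemma finrank_constOn (A : Finset (Sym2 V)) :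
    Module.finrank ℚ (constOn A) =
      Fintype.card (SimpleGraph.fromEdgeSet (A : Set (Sym2 V))).ConnectedComponent := by
  set G := SimpleGraph.fromEdgeSet (A : Set (Sym2 V))
  let F : (G.ConnectedComponent → ℚ) →ₗ[ℚ] (V → ℚ) := LinearMap.funLeft ℚ ℚ G.connectedComponentMk
  have hF : Function.Injective F :=
    LinearMap.funLeft_injective_of_surjective ℚ ℚ _ Quot.mk_surjective
  have hR : LinearMap.range F = constOn A := by
    ext f
    constructor
    · rintro ⟨g, rfl⟩ u v h
      by_cases huv : u = v
      · rw [huv]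
      · have : G.Adj u v := by simp [G, huv, h]
        simp only [F, LinearMap.funLeft_apply]
        rw [SimpleGraph.ConnectedComponent.sound this.reachable]
    · intro hf
      have key : ∀ u v, G.Reachable u v → f u = f v := by
        rintro u v ⟨p⟩
        induction p with
        | nil => rfl
        | cons h p ih =>
          rw [← ih]
          refine hf _ _ ?_
          simpa [G] using h.1
      refine ⟨Quot.lift f key, ?_⟩
      ext v
      rfl
  rw [← hR, LinearMap.finrank_range_of_inj hF, Module.finrank_fintype_fun_eq_card]

lemma isTree_of_graphRank [Nonempty V] {T : Finset (Sym2 V)} (hT : ∀ e ∈ T, ¬ e.IsDiag)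
    (hc : T.card = Fintype.card V - 1) (hr : graphRank T = Fintype.card V - 1) :
    (SimpleGraph.fromEdgeSet (T : Set (Sym2 V))).IsTree ∧
      (SimpleGraph.fromEdgeSet (T : Set (Sym2 V))).edgeSet = T := by
  have hE : (SimpleGraph.fromEdgeSet (T : Set (Sym2 V))).edgeSet = T := by
    rw [SimpleGraph.edgeSet_fromEdgeSet]
    ext e
    simp only [Set.mem_sdiff, Finset.mem_coe]
    exact ⟨fun h => h.1, fun h => ⟨h, hT e h⟩⟩
  have hpos : 0 < Fintype.card V := Fintype.card_pos
  refine ⟨SimpleGraph.isTree_iff_connected_and_card.2 ⟨?_, ?_⟩, hE⟩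
  · have h1 := finrank_constOn T
    have h2 := finrank_constOn_le T
    have h3 : 0 < Fintype.card
        (SimpleGraph.fromEdgeSet (T : Set (Sym2 V))).ConnectedComponent := Fintype.card_pos
    unfold graphRank at hr
    have h4 : Fintype.card
        (SimpleGraph.fromEdgeSet (T : Set (Sym2 V))).ConnectedComponent = 1 := by omega
    rw [SimpleGraph.connected_iff]
    refine ⟨fun u v => ?_, inferInstance⟩
    have := Fintype.card_le_one_iff.1 h4.le
    exact SimpleGraph.ConnectedComponent.exact (this _ _)
  · rw [hE]
    simp only [Nat.card_eq_fintype_card, Finset.coe_sort_coe, Fintype.card_coe, hc]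
    omega

end GraphRank

section Counting

variable {V : Type*} [Fintype V]

lemma ProperColoring.eq_of_mem {c : Sym2 V → ℕ} (hc : ProperColoring (⊤ : SimpleGraph V) c)
    {e f : Sym2 V} (he : ¬ e.IsDiag) (hf : ¬ f.IsDiag) (h : c e = c f) {v : V} (hve : v ∈ e)
    (hvf : v ∈ f) : e = f := by
  obtain ⟨a, rfl⟩ := hve
  obtain ⟨b, rfl⟩ := hvf
  by_contra hne
  refine hc (a := v) (b := a) (b' := b) ?_ ?_ ?_ h
  · simpa using he
  · simpa using hf
  · rintro rfl
    exact hne rfl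

lemma ProperColoring.mul_card_le {c : Sym2 V → ℕ} (hc : ProperColoring (⊤ : SimpleGraph V) c)
    {X : Finset (Sym2 V)} (hX : ∀ e ∈ X, ¬ e.IsDiag) {κ : ℕ} (hκ : ∀ e ∈ X, c e = κ)
    {Z : Finset V} {j : ℕ} (hj : ∀ e ∈ X, j ≤ (Z.filter (· ∈ e)).card) :
    j * X.card ≤ Z.card := by
  have hd : (X : Set (Sym2 V)).PairwiseDisjoint fun e => Z.filter (· ∈ e) := by
    intro e he f hf hne
    refine Finset.disjoint_left.2 fun v hv hv' => hne ?_
    exact hc.eq_of_mem (hX e he) (hX f hf) ((hκ e he).trans (hκ f hf).symm)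
      (Finset.mem_filter.1 hv).2 (Finset.mem_filter.1 hv').2
  calc j * X.card = ∑ e ∈ X, j := by simp [mul_comm]
    _ ≤ ∑ e ∈ X, (Z.filter (· ∈ e)).card := Finset.sum_le_sum hj
    _ = (X.biUnion fun e => Z.filter (· ∈ e)).card := (Finset.card_biUnion hd).symm
    _ ≤ Z.card := Finset.card_le_card (by
      intro v hv
      obtain ⟨e, -, hv⟩ := Finset.mem_biUnion.1 hv
      exact (Finset.mem_filter.1 hv).1)

lemma card_filter_mem_of_not_isDiag {e : Sym2 V} (he : ¬ e.IsDiag) :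
    ((Finset.univ : Finset V).filter (· ∈ e)).card = 2 := by
  induction e with
  | _ a b =>
    have : ((Finset.univ : Finset V).filter (· ∈ s(a, b))) = {a, b} := by
      ext v; simp
    rw [this, Finset.card_pair (by simpa using he)]

lemma ProperColoring.two_mul_card_le {c : Sym2 V → ℕ}
    (hc : ProperColoring (⊤ : SimpleGraph V) c)
    {X : Finset (Sym2 V)} (hX : ∀ e ∈ X, ¬ e.IsDiag) {κ : ℕ} (hκ : ∀ e ∈ X, c e = κ) :
    2 * X.card ≤ Fintype.card V :=
  hc.mul_card_le hX hκ (Z := Finset.univ) fun e he =>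
    (card_filter_mem_of_not_isDiag (hX e he)).ge

/-- The number of edges of `A` at the vertex `v`. -/
noncomputable def edgeDegree (A : Finset (Sym2 V)) (v : V) : ℕ := (A.filter (v ∈ ·)).card

lemma sum_edgeDegree {A : Finset (Sym2 V)} (hA : ∀ e ∈ A, ¬ e.IsDiag) :
    ∑ v, edgeDegree A v = 2 * A.card := by
  have := Finset.sum_card_bipartiteAbove_eq_sum_card_bipartiteBelow
    (s := (Finset.univ : Finset V)) (t := A) (fun v e => v ∈ e)
  unfold edgeDegree
  refine this.trans ?_
  unfold Finset.bipartiteBelow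
  rw [Finset.sum_congr rfl fun e he => card_filter_mem_of_not_isDiag (hA e he)]
  simp [mul_comm]

lemma card_neighbours_le (A : Finset (Sym2 V)) (v : V) :
    ((Finset.univ : Finset V).filter (fun u => s(v, u) ∈ A)).card ≤ edgeDegree A v := by
  refine Finset.card_le_card_of_injOn (fun u => s(v, u)) ?_ ?_
  · intro u hu
    have := (Finset.mem_filter.1 hu).2
    simp [this]
  · intro u _ u' _ h
    exact Sym2.congr_right.1 h

lemma card_colour_at_le {c : Sym2 V → ℕ} (hc : ProperColoring (⊤ : SimpleGraph V) c)
    (C : Finset ℕ) (v : V) :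
    ((Finset.univ : Finset V).filter (fun u => u ≠ v ∧ c s(v, u) ∈ C)).card ≤ C.card := by
  refine Finset.card_le_card_of_injOn (fun u => c s(v, u)) ?_ ?_
  · intro u hu
    exact (Finset.mem_filter.1 hu).2.2
  · intro u hu u' hu' h
    have h1 := (Finset.mem_filter.1 hu).2.1
    have h2 := (Finset.mem_filter.1 hu').2.1
    exact Sym2.congr_right.1 (hc.eq_of_mem (e := s(v, u)) (f := s(v, u')) (v := v)
      (by simpa using h1.symm) (by simpa using h2.symm) h (by simp) (by simp))

variable {K : Type*} [Fintype K]

/-- The edges of `E` whose ends are separated by `π`. -/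
noncomputable def crossing (π : V → K) (E : Finset (Sym2 V)) : Finset (Sym2 V) :=
  E.filter fun e => ¬ (e.map π).IsDiag

lemma mem_crossing {π : V → K} {E : Finset (Sym2 V)} {u v : V} :
    s(u, v) ∈ crossing π E ↔ s(u, v) ∈ E ∧ π u ≠ π v := by
  simp [crossing]

lemma crossing_subset {π : V → K} {E : Finset (Sym2 V)} : crossing π E ⊆ E :=
  Finset.filter_subset _ _

lemma card_eq_sum_fibres (L : Finset V) (π : V → K) :
    L.card = ∑ κ, (L.filter (π · = κ)).card :=
  Finset.card_eq_sum_card_fiberwise (fun _ _ => Finset.mem_coe.2 (Finset.mem_univ _))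

/-- A colour class in `L` with more edges than the excess of the partition has a crossing edge. -/
lemma exists_crossing_of_card_lt {c : Sym2 V → ℕ}
    (hc : ProperColoring (⊤ : SimpleGraph V) c) {L : Finset V} {π : V → K}
    (hπ : ∀ κ, ∃ v ∈ L, π v = κ) {X : Finset (Sym2 V)} (hX : ∀ e ∈ X, ¬ e.IsDiag) {κ : ℕ}
    (hκ : ∀ e ∈ X, c e = κ) (hL : ∀ e ∈ X, ∀ v ∈ e, v ∈ L)
    (hcard : L.card < X.card + Fintype.card K) : ∃ e ∈ X, ¬ (e.map π).IsDiag := by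
  by_contra! hcon
  choose ρ hρL hρ using hπ
  have hinj : Function.Injective ρ := fun a b h => by rw [← hρ a, h, hρ b]
  have h1 := hc.mul_card_le hX hκ (Z := L \ Finset.univ.image ρ) (j := 1) (by
    intro e he
    rw [Nat.succ_le_iff, Finset.card_pos]
    have hne := hX e he
    have hl := hL e he
    have hd := hcon e he
    induction e with
    | _ a b =>
      have hab : a ≠ b := by simpa using hne
      have hπab : π a = π b := by simpa using hd
      by_cases ha : a ∈ Finset.univ.image ρ
      · refine ⟨b, ?_⟩
        have hb : b ∉ Finset.univ.image ρ := by
          intro hb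
          obtain ⟨k, -, rfl⟩ := Finset.mem_image.1 ha
          obtain ⟨k', -, rfl⟩ := Finset.mem_image.1 hb
          rw [hρ, hρ] at hπab
          exact hab (by rw [hπab])
        simp only [Finset.mem_filter, Finset.mem_sdiff]
        exact ⟨⟨hl b (by simp), hb⟩, by simp⟩
      · refine ⟨a, ?_⟩
        simp only [Finset.mem_filter, Finset.mem_sdiff]
        exact ⟨⟨hl a (by simp), ha⟩, by simp⟩)
  have h2 : (L \ Finset.univ.image ρ).card + Fintype.card K = L.card := by
    rw [← Finset.card_univ, ← Finset.card_image_of_injective Finset.univ hinj]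
    refine Finset.card_sdiff_add_card_eq_card ?_
    intro v hv
    obtain ⟨k, -, rfl⟩ := Finset.mem_image.1 hv
    exact hρL k
  omega

/-- If `L` is everything but the leaves of a matching, each leaf being in the part of its
neighbour, then few vertices lie in parts that contain two vertices of `L`. -/
lemma card_nontrivial_parts_le {L W : Finset V} (hLW : ∀ v, v ∈ L ∨ v ∈ W) {π : V → K}
    (hπ : ∀ κ, ∃ v ∈ L, π v = κ) {x : V → V} (hxL : ∀ w ∈ W, x w ∈ L)
    (hxπ : ∀ w ∈ W, π (x w) = π w) (hxi : Set.InjOn x W) :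
    ((Finset.univ : Finset V).filter fun v => 2 ≤ (L.filter (π · = π v)).card).card
      + 4 * Fintype.card K ≤ 4 * L.card := by
  set U := (Finset.univ : Finset V).filter fun v => 2 ≤ (L.filter (π · = π v)).card with hU
  have h1 : (U ∩ L).card + 2 * Fintype.card K ≤ 2 * L.card := by
    have hsum := card_eq_sum_fibres (U ∩ L) π
    have hsum' := card_eq_sum_fibres L π
    have : ∀ κ, ((U ∩ L).filter (π · = κ)).card + 2 ≤ 2 * (L.filter (π · = κ)).card := by
      intro κ
      obtain ⟨v, hv, hvκ⟩ := hπ κ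
      have hpos : 0 < (L.filter (π · = κ)).card :=
        Finset.card_pos.2 ⟨v, Finset.mem_filter.2 ⟨hv, hvκ⟩⟩
      by_cases h2 : 2 ≤ (L.filter (π · = κ)).card
      · have : ((U ∩ L).filter (π · = κ)).card ≤ (L.filter (π · = κ)).card :=
          Finset.card_le_card (Finset.filter_subset_filter _ Finset.inter_subset_right)
        omega
      · have : ((U ∩ L).filter (π · = κ)) = ∅ := by
          rw [Finset.filter_eq_empty_iff]
          rintro u hu rfl
          exact h2 (Finset.mem_filter.1 (Finset.mem_inter.1 hu).1).2
        rw [this, Finset.card_empty]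
        omega
    have h := Finset.sum_le_sum fun κ (_ : κ ∈ Finset.univ) => this κ
    rw [Finset.sum_add_distrib, ← hsum, ← Finset.mul_sum, ← hsum'] at h
    simp only [Finset.sum_const, Finset.card_univ, smul_eq_mul] at h
    omega
  have h2 : (U \ L).card ≤ (U ∩ L).card := by
    have hW : ∀ v ∈ U \ L, v ∈ W := fun v hv =>
      (hLW v).resolve_left (Finset.mem_sdiff.1 hv).2
    refine Finset.card_le_card_of_injOn x ?_ ?_
    · intro v hv
      have hv' := Finset.mem_coe.1 hv
      refine Finset.mem_coe.2 (Finset.mem_inter.2 ⟨?_, hxL v (hW v hv')⟩)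
      rw [hU, Finset.mem_filter, hxπ v (hW v hv')]
      exact ⟨Finset.mem_univ _, (Finset.mem_filter.1 (Finset.mem_sdiff.1 hv').1).2⟩
    · exact hxi.mono fun v hv => hW v (Finset.mem_coe.1 hv)
  have h3 := Finset.card_sdiff_add_card_inter U L
  omega

/-- Non-crossing edges that are not in the matching lie in the nontrivial parts. -/
lemma card_noncrossing_le {L W : Finset V} (hLW : ∀ v, v ∈ L ∨ v ∈ W)
    {π : V → K} (hπ : ∀ κ, ∃ v ∈ L, π v = κ) {x : V → V} (hxL : ∀ w ∈ W, x w ∈ L)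
    (hxπ : ∀ w ∈ W, π (x w) = π w) (hxi : Set.InjOn x W) {X : Finset (Sym2 V)}
    (hX : ∀ e ∈ X, ¬ e.IsDiag) (hxX : ∀ w ∈ W, s(w, x w) ∉ X)
    (hd : ∀ e ∈ X, (e.map π).IsDiag) :
    X.card ≤ 16 * (L.card - Fintype.card K) ^ 2 := by
  set U := (Finset.univ : Finset V).filter fun v => 2 ≤ (L.filter (π · = π v)).card with hU
  have hUc : U.card ≤ 4 * (L.card - Fintype.card K) := by
    have : U.card + 4 * Fintype.card K ≤ 4 * L.card :=
      card_nontrivial_parts_le hLW hπ hxL hxπ hxi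
    omega
  have key : ∀ a b, s(a, b) ∈ X → a ∈ U := by
    intro a b hab
    have hne : a ≠ b := by simpa using hX _ hab
    have hπab : π a = π b := by simpa using hd _ hab
    by_contra haU
    have hle : (L.filter (π · = π a)).card ≤ 1 := by
      rw [hU, Finset.mem_filter] at haU
      simp only [Finset.mem_univ, true_and, not_le] at haU
      omega
    have huniq : ∀ u ∈ L, ∀ v ∈ L, π u = π a → π v = π a → u = v := fun u hu v hv h h' =>
      Finset.card_le_one.1 hle u (Finset.mem_filter.2 ⟨hu, h⟩) v (Finset.mem_filter.2 ⟨hv, h'⟩)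
    rcases hLW a with ha | ha
    · rcases hLW b with hb | hb
      · exact hne (huniq a ha b hb rfl hπab.symm)
      · have := huniq a ha (x b) (hxL b hb) rfl ((hxπ b hb).trans hπab.symm)
        refine hxX b hb ?_
        rw [← this, Sym2.eq_swap]
        exact hab
    · rcases hLW b with hb | hb
      · have := huniq b hb (x a) (hxL a ha) hπab.symm (hxπ a ha)
        refine hxX a ha ?_
        rw [← this]
        exact hab
      · exact hne (hxi ha hb (huniq _ (hxL a ha) _ (hxL b hb) (hxπ a ha)
          ((hxπ b hb).trans hπab.symm)))
  have hsub : X ⊆ (U ×ˢ U).image fun p => s(p.1, p.2) := by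
    intro e he
    induction e with
    | _ a b =>
      exact Finset.mem_image.2 ⟨(a, b), Finset.mem_product.2
        ⟨key a b he, key b a (by rwa [Sym2.eq_swap])⟩, rfl⟩
  have hXc : X.card ≤ U.card * U.card :=
    (Finset.card_le_card hsub).trans (Finset.card_image_le.trans (Finset.card_product _ _).le)
  have := Nat.mul_le_mul hUc hUc
  nlinarith

end Counting

section Crossing

variable {V : Type*} [Fintype V] {K : Type*} [Fintype K]

lemma card_le_mul_colours {β : Type*} {c : β → ℕ} {Y : Finset β} {C : Finset ℕ}
    (hY : ∀ e ∈ Y, c e ∈ C) {m : ℝ}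
    (hm : ∀ κ ∈ C, ((Y.filter (c · = κ)).card : ℝ) ≤ m) :
    (Y.card : ℝ) ≤ C.card * m := by
  rw [Finset.card_eq_sum_card_fiberwise hY, Nat.cast_sum]
  exact (Finset.sum_le_sum hm).trans (by simp)

lemma card_image_sdiff_le {β : Type*} {c : β → ℕ} {Φ : Finset ℕ} {d : ℕ} {X Y : Finset β}
    (h : Y ⊆ X) : (Y.image c \ Φ).card ≤ cappedColours c Φ d X :=
  (Finset.card_le_card (Finset.sdiff_subset_sdiff (Finset.image_subset_image h)
    le_rfl)).trans (Nat.le_add_right _ _)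

lemma card_le_cappedColours_of_small {c : Sym2 V → ℕ}
    (hc : ProperColoring (⊤ : SimpleGraph V) c) {L W : Finset V} (hLW : ∀ v, v ∈ L ∨ v ∈ W)
    {π : V → K} (hπ : ∀ κ, ∃ v ∈ L, π v = κ) {y : V → V} (hyL : ∀ w ∈ W, y w ∈ L)
    (hyπ : ∀ w ∈ W, π (y w) = π w) (hyi : Set.InjOn y W) {E : Finset (Sym2 V)}
    (hE : ∀ e ∈ E, ¬ e.IsDiag) (hyE : ∀ w ∈ W, s(w, y w) ∉ E) {S Φ : Finset ℕ}
    (hSΦ : Disjoint S Φ) {x : ℝ} (hx : 0 < x) (hn : 2 * x ≤ Fintype.card V) {d l : ℕ}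
    (hd : 150 * d ≤ x)
    (hS : ∀ κ ∈ S, 19 / 100 * x ≤ ((E.filter fun e => c e = κ ∧ ∀ v ∈ e, v ∈ L).card : ℝ))
    (hcard : L.card + l ≤ S.card + d + 1)
    (hΦ : ∀ κ ∈ Φ, ((E.filter (c · = κ)).card : ℝ) ≤ x / 5)
    (hΦE : 239 / 1000 * Fintype.card V * d - x / 5 * l ≤ ((E.filter (c · ∈ Φ)).card : ℝ))
    (hsmall : (L.card : ℝ) - Fintype.card K < 19 / 100 * x) :
    Fintype.card K ≤ cappedColours c Φ d (crossing π E) + 1 := by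
  have hKL : Fintype.card K ≤ L.card := by
    have : (Finset.univ : Finset K) ⊆ L.image π := by
      intro κ _
      obtain ⟨v, hv, rfl⟩ := hπ κ
      exact Finset.mem_image_of_mem _ hv
    exact (Finset.card_le_card this).trans Finset.card_image_le
  have hSX : S ⊆ (crossing π E).image c \ Φ := by
    intro κ hκ
    have h1 := hS κ hκ
    obtain ⟨e, he, hed⟩ := exists_crossing_of_card_lt hc hπ
      (X := E.filter fun e => c e = κ ∧ ∀ v ∈ e, v ∈ L)
      (fun e he => hE e (Finset.mem_filter.1 he).1) (fun e he => (Finset.mem_filter.1 he).2.1)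
      (fun e he => (Finset.mem_filter.1 he).2.2) (by
        have : (L.card : ℝ) < (E.filter fun e => c e = κ ∧ ∀ v ∈ e, v ∈ L).card
          + Fintype.card K := by linarith
        exact_mod_cast this)
    have he' := Finset.mem_filter.1 he
    exact Finset.mem_sdiff.2 ⟨Finset.mem_image.2 ⟨e, Finset.mem_filter.2 ⟨he'.1, hed⟩, he'.2.1⟩,
      Finset.disjoint_left.1 hSΦ hκ⟩
  have hSc := Finset.card_le_card hSX
  unfold cappedColours
  by_cases hed : Fintype.card K + d ≤ L.card
  · omega
  suffices d ≤ ((crossing π E).image c ∩ Φ).card + l by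
    have := min_def d ((crossing π E).image c ∩ Φ).card
    split_ifs at this <;> omega
  have hsplit := Finset.card_filter_add_card_filter_not (s := E.filter (c · ∈ Φ))
    (fun e => (e.map π).IsDiag)
  have hnon : ((E.filter (c · ∈ Φ)).filter fun e => (e.map π).IsDiag).card
      ≤ 16 * (L.card - Fintype.card K) ^ 2 :=
    card_noncrossing_le hLW hπ hyL hyπ hyi
      (fun e he => hE e (Finset.mem_filter.1 (Finset.mem_filter.1 he).1).1)
      (fun w hw he => hyE w hw (Finset.mem_filter.1 (Finset.mem_filter.1 he).1).1)
      (fun e he => (Finset.mem_filter.1 he).2)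
  have hcr : ((((E.filter (c · ∈ Φ)).filter fun e => ¬ (e.map π).IsDiag).card : ℕ) : ℝ)
      ≤ ((crossing π E).image c ∩ Φ).card * (x / 5) := by
    refine card_le_mul_colours (c := c) ?_ ?_
    · intro e he
      have he' := Finset.mem_filter.1 he
      have he'' := Finset.mem_filter.1 he'.1
      exact Finset.mem_inter.2 ⟨Finset.mem_image_of_mem _ (Finset.mem_filter.2 ⟨he''.1, he'.2⟩),
        he''.2⟩
    · intro κ hκ
      refine le_trans ?_ (hΦ κ (Finset.mem_inter.1 hκ).2)
      exact_mod_cast Finset.card_le_card (Finset.filter_subset_filter _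
        ((Finset.filter_subset _ _).trans (Finset.filter_subset _ _)))
  have hsq : (L.card - Fintype.card K) ^ 2 ≤ d ^ 2 := Nat.pow_le_pow_left (by omega) 2
  have hsplit' : (((E.filter (c · ∈ Φ)).card : ℕ) : ℝ)
      ≤ 16 * (d : ℝ) ^ 2 + ((crossing π E).image c ∩ Φ).card * (x / 5) := by
    have h1 : (((E.filter (c · ∈ Φ)).filter fun e => (e.map π).IsDiag).card : ℝ)
        ≤ 16 * (d : ℝ) ^ 2 := by
      exact_mod_cast hnon.trans (Nat.mul_le_mul_left 16 hsq)
    rw [← hsplit]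
    push_cast
    linarith
  have hd0 : (0 : ℝ) ≤ d := Nat.cast_nonneg d
  have hfin : (d : ℝ) * (x / 5) ≤ (((crossing π E).image c ∩ Φ).card + l) * (x / 5) := by
    nlinarith
  have := le_of_mul_le_mul_right hfin (by linarith)
  exact_mod_cast this

lemma fibre_complement_le {L : Finset V} {π : V → K} {E : Finset (Sym2 V)} {D : ℕ} {u : V}
    (hD : (L.filter fun v => v ≠ u ∧ s(u, v) ∉ E).card ≤ D) :
    L.card ≤ (L.filter (π · = π u)).card + edgeDegree (crossing π E) u + D := by
  have h := card_neighbours_le (crossing π E) u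
  have hsub : L ⊆ L.filter (π · = π u) ∪
      Finset.univ.filter (fun v => s(u, v) ∈ crossing π E) ∪
      L.filter fun v => v ≠ u ∧ s(u, v) ∉ E := by
    intro v hv
    simp only [Finset.mem_union, Finset.mem_filter, Finset.mem_univ, true_and, mem_crossing]
    by_cases h1 : π v = π u
    · exact .inl (.inl ⟨hv, h1⟩)
    · by_cases h2 : s(u, v) ∈ E
      · exact .inl (.inr ⟨h2, fun h => h1 h.symm⟩)
      · exact .inr ⟨hv, fun h => h1 (by rw [h]), h2⟩
  have h1 := Finset.card_le_card hsub
  have h2 := Finset.card_union_le (L.filter (π · = π u) ∪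
      Finset.univ.filter (fun v => s(u, v) ∈ crossing π E))
      (L.filter fun v => v ≠ u ∧ s(u, v) ∉ E)
  have h3 := Finset.card_union_le (L.filter (π · = π u))
      (Finset.univ.filter (fun v => s(u, v) ∈ crossing π E))
  omega

lemma card_le_cappedColours_of_balanced {c : Sym2 V → ℕ}
    (hc : ProperColoring (⊤ : SimpleGraph V) c) {L : Finset V}
    {π : V → K} (hπ : ∀ κ, ∃ v ∈ L, π v = κ) {E : Finset (Sym2 V)}
    (hE : ∀ e ∈ E, ¬ e.IsDiag) {Φ : Finset ℕ} {x : ℝ} (hx : 0 < x)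
    (hn : 2 * x ≤ Fintype.card V) {d D w : ℕ} (hd : 150 * d ≤ x) (hDx : 50 * D ≤ x)
    (hw : 5000 * w ≤ x) (hLw : Fintype.card V = L.card + w)
    (hD : ∀ u ∈ L, (L.filter fun v => v ≠ u ∧ s(u, v) ∉ E).card ≤ D)
    (hΦ : 20 * ((E.filter (c · ∈ Φ)).card : ℝ) ≤ 9 * (Fintype.card V : ℝ) * d)
    (hlarge : 19 / 100 * x ≤ (L.card : ℝ) - Fintype.card K)
    (hbal : ∀ κ, 5 * (L.filter (π · = κ)).card ≤ 3 * L.card) :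
    Fintype.card K ≤ cappedColours c Φ d (crossing π E) + 1 := by
  set X := crossing π E with hX
  have hXd : ∀ e ∈ X, ¬ e.IsDiag := fun e he => hE e (crossing_subset he)
  set Y := X.filter (c · ∉ Φ) with hY
  have hYX : Y ⊆ X := Finset.filter_subset _ _
  have hcol := card_image_sdiff_le (c := c) (Φ := Φ) (d := d) hYX
  have hYc : (Y.card : ℝ) ≤ (Y.image c \ Φ).card * ((Fintype.card V : ℝ) / 2) := by
    refine card_le_mul_colours (c := c) ?_ ?_
    · intro e he
      exact Finset.mem_sdiff.2 ⟨Finset.mem_image_of_mem _ he, (Finset.mem_filter.1 he).2⟩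
    · intro κ _
      have := hc.two_mul_card_le (X := Y.filter (c · = κ))
        (fun e he => hXd e (hYX (Finset.mem_filter.1 he).1)) (fun e he => (Finset.mem_filter.1 he).2)
      have : (2 : ℝ) * (Y.filter (c · = κ)).card ≤ Fintype.card V := by exact_mod_cast this
      linarith
  have hXY : (X.card : ℝ) ≤ Y.card + (E.filter (c · ∈ Φ)).card := by
    have h1 := Finset.card_filter_add_card_filter_not (s := X) (fun e => c e ∈ Φ)
    have h2 : (X.filter (c · ∈ Φ)).card ≤ (E.filter (c · ∈ Φ)).card :=
      Finset.card_le_card (Finset.filter_subset_filter _ crossing_subset)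
    have : X.card ≤ Y.card + (E.filter (c · ∈ Φ)).card := by
      rw [hY]; omega
    exact_mod_cast this
  have hsum : L.card * L.card ≤ ∑ κ, (L.filter (π · = κ)).card ^ 2 + 2 * X.card + D * L.card := by
    have h1 := Finset.sum_le_sum fun u hu => fibre_complement_le (π := π) (hD u hu)
    rw [Finset.sum_add_distrib, Finset.sum_add_distrib] at h1
    simp only [Finset.sum_const, smul_eq_mul] at h1
    have h2 : ∑ u ∈ L, edgeDegree X u ≤ 2 * X.card := by
      rw [← sum_edgeDegree hXd]
      exact Finset.sum_le_sum_of_subset (Finset.subset_univ _)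
    have h3 : ∑ u ∈ L, (L.filter (π · = π u)).card = ∑ κ, (L.filter (π · = κ)).card ^ 2 := by
      rw [← Finset.sum_fiberwise_of_maps_to (s := L) (t := Finset.univ) (g := π)
        (fun _ _ => Finset.mem_univ _)]
      refine Finset.sum_congr rfl fun κ _ => ?_
      rw [Finset.sum_congr rfl (g := fun _ => (L.filter (π · = κ)).card)]
      · simp [sq]
      · intro u hu
        rw [(Finset.mem_filter.1 hu).2]
    rw [h3] at h1
    nlinarith
  have hsq : 5 * ∑ κ, (L.filter (π · = κ)).card ^ 2 + 3 * L.card * Fintype.card K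
      ≤ 5 * L.card + 3 * L.card * L.card := by
    have h1 : ∀ κ, 5 * (L.filter (π · = κ)).card ^ 2 + 3 * L.card
        ≤ 5 * (L.filter (π · = κ)).card + 3 * L.card * (L.filter (π · = κ)).card := by
      intro κ
      obtain ⟨v, hv, hvκ⟩ := hπ κ
      have hpos : 0 < (L.filter (π · = κ)).card :=
        Finset.card_pos.2 ⟨v, Finset.mem_filter.2 ⟨hv, hvκ⟩⟩
      obtain ⟨b, hb⟩ := Nat.exists_eq_add_of_lt hpos
      have := Nat.mul_le_mul_right b (hbal κ)
      rw [hb] at this ⊢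
      nlinarith
    have h2 := Finset.sum_le_sum fun κ (_ : κ ∈ Finset.univ) => h1 κ
    have h3 := card_eq_sum_fibres L π
    rw [Finset.sum_add_distrib, Finset.sum_add_distrib, ← Finset.mul_sum, ← Finset.mul_sum,
      ← Finset.mul_sum, ← Finset.mul_sum, ← h3] at h2
    simp only [Finset.sum_const, smul_eq_mul, Finset.card_univ] at h2
    nlinarith
  have hsum' : (L.card : ℝ) * L.card ≤ (∑ κ, (L.filter (π · = κ)).card ^ 2 : ℕ) + 2 * X.card
      + D * L.card := by exact_mod_cast hsum
  have hsq' : 5 * ((∑ κ, (L.filter (π · = κ)).card ^ 2 : ℕ) : ℝ) + 3 * L.card * Fintype.card K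
      ≤ 5 * L.card + 3 * L.card * L.card := by exact_mod_cast hsq
  have hn' : (Fintype.card V : ℝ) = L.card + w := by exact_mod_cast hLw
  suffices (Fintype.card K : ℝ) ≤ (Y.image c \ Φ).card + 1 by
    have : Fintype.card K ≤ (Y.image c \ Φ).card + 1 := by exact_mod_cast this
    omega
  have hn0 : (0 : ℝ) < Fintype.card V := by linarith
  refine le_of_mul_le_mul_right ?_ hn0
  generalize ((∑ κ, (L.filter (π · = κ)).card ^ 2 : ℕ) : ℝ) = Q at *
  generalize ((Y.image c \ Φ).card : ℝ) = p at *
  have hL0 : (0 : ℝ) ≤ L.card := Nat.cast_nonneg _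
  have hw0 : (0 : ℝ) ≤ w := Nat.cast_nonneg _
  have hK0 : (0 : ℝ) ≤ Fintype.card K := Nat.cast_nonneg _
  rw [hn'] at hYc hn0 hΦ ⊢
  generalize (L.card : ℝ) = m at *
  generalize (w : ℝ) = w at *
  generalize (Fintype.card K : ℝ) = s at *
  have h1 : m * (19 / 100 * x) ≤ m * (m - s) := mul_le_mul_of_nonneg_left hlarge hL0
  have h2 : m * (50 * D) ≤ m * x := mul_le_mul_of_nonneg_left hDx hL0
  have h3 : m * (5000 * w) ≤ m * x := mul_le_mul_of_nonneg_left hw hL0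
  have h4 : (m + w) * (150 * d) ≤ (m + w) * x := mul_le_mul_of_nonneg_left hd (by linarith)
  have h5 : w * s ≤ w * m := mul_le_mul_of_nonneg_left (by linarith) hw0
  have h6 : w * x ≤ m * x := mul_le_mul_of_nonneg_right (by linarith) hx.le
  nlinarith

lemma card_le_cappedColours_of_big_part {c : Sym2 V → ℕ}
    (hc : ProperColoring (⊤ : SimpleGraph V) c) {L : Finset V}
    {π : V → K} (hπ : ∀ κ, ∃ v ∈ L, π v = κ) {E : Finset (Sym2 V)}
    (hE : ∀ e ∈ E, ¬ e.IsDiag) {Φ : Finset ℕ} {x : ℝ} (hx : 0 < x)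
    (hn : 2 * x ≤ Fintype.card V) {d D w : ℕ} (hd : 150 * d ≤ x) (hDx : 50 * D ≤ x)
    (hw : 5000 * w ≤ x) (hLw : Fintype.card V = L.card + w)
    (hD : ∀ u ∈ L, (L.filter fun v => v ≠ u ∧ s(u, v) ∉ E).card ≤ D)
    (hΦ : 20 * ((E.filter (c · ∈ Φ)).card : ℝ) ≤ 9 * (Fintype.card V : ℝ) * d)
    {κ₀ : K} (hbig : 3 * L.card < 5 * (L.filter (π · = κ₀)).card) :
    Fintype.card K ≤ cappedColours c Φ d (crossing π E) + 1 := by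
  set A := L.filter (π · = κ₀) with hA
  set Z := L.filter (π · ≠ κ₀) with hZ
  have hAZ : A.card + Z.card = L.card := Finset.card_filter_add_card_filter_not _
  have hKZ : Fintype.card K ≤ Z.card + 1 := by
    have h1 : (Finset.univ : Finset K).erase κ₀ ⊆ Z.image π := by
      intro κ hκ
      obtain ⟨v, hv, rfl⟩ := hπ κ
      exact Finset.mem_image_of_mem _ (Finset.mem_filter.2 ⟨hv, (Finset.mem_erase.1 hκ).1⟩)
    have h2 := (Finset.card_le_card h1).trans Finset.card_image_le
    rw [Finset.card_erase_of_mem (Finset.mem_univ _), Finset.card_univ] at h2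
    omega
  set P := Z.sigma fun u => A.filter fun v => s(u, v) ∈ E with hP
  set Y := P.image fun p => s(p.1, p.2) with hY
  have hPc : Z.card * A.card ≤ P.card + Z.card * D := by
    rw [hP, Finset.card_sigma]
    have : ∀ u ∈ Z, A.card ≤ (A.filter fun v => s(u, v) ∈ E).card + D := by
      intro u hu
      have h1 := Finset.card_filter_add_card_filter_not (s := A) (fun v => s(u, v) ∈ E)
      have h2 : (A.filter fun v => ¬ s(u, v) ∈ E).card ≤ D := by
        refine (Finset.card_le_card ?_).trans (hD u (Finset.mem_filter.1 hu).1)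
        intro v hv
        have hv1 := Finset.mem_filter.1 hv
        have hv2 := Finset.mem_filter.1 hv1.1
        refine Finset.mem_filter.2 ⟨hv2.1, ?_, hv1.2⟩
        rintro rfl
        exact (Finset.mem_filter.1 hu).2 hv2.2
      omega
    have h := Finset.sum_le_sum this
    rw [Finset.sum_add_distrib] at h
    simpa using h
  have hYP : Y.card = P.card := by
    refine Finset.card_image_of_injOn ?_
    rintro ⟨u, v⟩ hp ⟨u', v'⟩ hp' h
    have hp := Finset.mem_sigma.1 (Finset.mem_coe.1 hp)
    have hp' := Finset.mem_sigma.1 (Finset.mem_coe.1 hp')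
    simp only [Finset.mem_filter, hA, hZ] at hp hp'
    rcases Sym2.eq_iff.1 h with ⟨h1, h2⟩ | ⟨h1, h2⟩
    · simp only at h1 h2
      subst h1 h2
      rfl
    · simp only at h1 h2
      subst h1 h2
      exact absurd hp'.2.1.2 hp.1.2
  have hYX : Y ⊆ crossing π E := by
    intro e he
    obtain ⟨⟨u, v⟩, hp, rfl⟩ := Finset.mem_image.1 he
    have hp := Finset.mem_sigma.1 hp
    simp only [Finset.mem_filter, hA, hZ] at hp
    exact mem_crossing.2 ⟨hp.2.2, fun h => hp.1.2 (h.trans hp.2.1.2)⟩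
  have hYZ : ∀ κ, ((Y.filter (c · = κ)).card : ℝ) ≤ Z.card := by
    intro κ
    have := hc.mul_card_le (X := Y.filter (c · = κ)) (Z := Z) (j := 1)
      (fun e he => hE e (crossing_subset (hYX (Finset.mem_filter.1 he).1)))
      (fun e he => (Finset.mem_filter.1 he).2) (by
        intro e he
        obtain ⟨⟨u, v⟩, hp, rfl⟩ := Finset.mem_image.1 (Finset.mem_filter.1 he).1
        rw [Nat.succ_le_iff, Finset.card_pos]
        exact ⟨u, Finset.mem_filter.2 ⟨(Finset.mem_sigma.1 hp).1, by simp⟩⟩)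
    rw [one_mul] at this
    exact_mod_cast this
  have hYn : ∀ κ, ((Y.filter (c · = κ)).card : ℝ) ≤ (Fintype.card V : ℝ) / 2 := by
    intro κ
    have := hc.two_mul_card_le (X := Y.filter (c · = κ))
      (fun e he => hE e (crossing_subset (hYX (Finset.mem_filter.1 he).1)))
      (fun e he => (Finset.mem_filter.1 he).2)
    have : (2 : ℝ) * (Y.filter (c · = κ)).card ≤ Fintype.card V := by exact_mod_cast this
    linarith
  set F := Y.filter (c · ∈ Φ) with hF
  set G := Y.filter (c · ∉ Φ) with hG
  have hFG : F.card + G.card = Y.card := Finset.card_filter_add_card_filter_not _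
  have hmono : ∀ {Y' : Finset (Sym2 V)} (_ : Y' ⊆ Y) {m : ℝ}
      (_ : ∀ κ, ((Y.filter (c · = κ)).card : ℝ) ≤ m) (κ : ℕ),
      ((Y'.filter (c · = κ)).card : ℝ) ≤ m := by
    intro Y' h m hm κ
    refine le_trans ?_ (hm κ)
    exact_mod_cast Finset.card_le_card (Finset.filter_subset_filter _ h)
  have hGmem : ∀ e ∈ G, c e ∈ Y.image c \ Φ := fun e he =>
    Finset.mem_sdiff.2 ⟨Finset.mem_image_of_mem _ (Finset.filter_subset _ _ he),
      (Finset.mem_filter.1 he).2⟩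
  have hG1 : (G.card : ℝ) ≤ (Y.image c \ Φ).card * (Z.card : ℝ) :=
    card_le_mul_colours hGmem fun κ _ => hmono (Finset.filter_subset _ _) hYZ κ
  have hG2 : (G.card : ℝ) ≤ (Y.image c \ Φ).card * ((Fintype.card V : ℝ) / 2) :=
    card_le_mul_colours hGmem fun κ _ => hmono (Finset.filter_subset _ _) hYn κ
  have hF1 : (F.card : ℝ) ≤ (Y.image c ∩ Φ).card * (Z.card : ℝ) :=
    card_le_mul_colours (fun e he => Finset.mem_inter.2
      ⟨Finset.mem_image_of_mem _ (Finset.filter_subset _ _ he), (Finset.mem_filter.1 he).2⟩)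
      fun κ _ => hmono (Finset.filter_subset _ _) hYZ κ
  have hFE : (F.card : ℝ) ≤ (E.filter (c · ∈ Φ)).card := by
    exact_mod_cast Finset.card_le_card
      (Finset.filter_subset_filter _ (hYX.trans crossing_subset))
  have hcap : (Y.image c \ Φ).card + min d (Y.image c ∩ Φ).card
      ≤ cappedColours c Φ d (crossing π E) :=
    (isRank_cappedColours c Φ d).mono hYX
  have hn' : (Fintype.card V : ℝ) = L.card + w := by exact_mod_cast hLw
  have hPc' : (Z.card : ℝ) * A.card ≤ F.card + G.card + Z.card * D := by
    have : Z.card * A.card ≤ F.card + G.card + Z.card * D := by rw [hFG, hYP]; exact hPc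
    exact_mod_cast this
  have hbig' : (3 : ℝ) * L.card < 5 * A.card := by exact_mod_cast hbig
  have hZ0 : (0 : ℝ) ≤ Z.card := Nat.cast_nonneg _
  have hAD : 58 / 100 * (Fintype.card V : ℝ) ≤ A.card - D := by linarith
  have hY58 : 58 / 100 * (Fintype.card V : ℝ) * Z.card ≤ F.card + G.card := by
    nlinarith [mul_le_mul_of_nonneg_left hAD hZ0]
  have hn0 : (0 : ℝ) < Fintype.card V := by linarith
  rcases Nat.eq_zero_or_pos Z.card with hz | hz
  · omega
  have hz' : (0 : ℝ) < Z.card := by exact_mod_cast hz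
  by_cases hF8 : (F.card : ℝ) ≤ 8 / 100 * (Fintype.card V : ℝ) * Z.card
  · have : (Z.card : ℝ) ≤ (Y.image c \ Φ).card := by
      refine le_of_mul_le_mul_right ?_ (show (0 : ℝ) < (Fintype.card V : ℝ) / 2 by linarith)
      nlinarith
    have : Z.card ≤ (Y.image c \ Φ).card := by exact_mod_cast this
    omega
  · push Not at hF8
    have hq : d ≤ (Y.image c ∩ Φ).card := by
      have h1 : 8 / 100 * (Fintype.card V : ℝ) < (Y.image c ∩ Φ).card :=
        lt_of_mul_lt_mul_right (hF8.trans_le hF1) hz'.le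
      have : (d : ℝ) ≤ (Y.image c ∩ Φ).card := by linarith
      exact_mod_cast this
    rw [min_eq_left hq] at hcap
    by_cases hzd : Z.card ≤ d
    · omega
    · have hzd' : (d : ℝ) ≤ Z.card := by
        exact_mod_cast (not_le.1 hzd).le
      have hp : 13 / 100 * (Fintype.card V : ℝ) ≤ (Y.image c \ Φ).card := by
        refine le_of_mul_le_mul_right ?_ hz'
        nlinarith [mul_le_mul_of_nonneg_left hzd' hn0.le]
      have hzs : 8 * (Z.card : ℝ) ≤ 45 * d := by
        refine le_of_mul_le_mul_right ?_ hn0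
        nlinarith
      have : (Z.card : ℝ) ≤ (Y.image c \ Φ).card := by linarith
      have : Z.card ≤ (Y.image c \ Φ).card := by exact_mod_cast this
      omega

end Crossing

universe u

lemma rainbow_of_cappedColours_eq_card {β : Type*} {c : β → ℕ} {Φ : Finset ℕ} {d : ℕ}
    {I : Finset β} (h : cappedColours c Φ d I = I.card) :
    Set.InjOn c I ∧ (I.filter (c · ∈ Φ)).card ≤ d := by
  have h1 : (I.image c).card ≤ I.card := Finset.card_image_le
  have h2 := Finset.card_sdiff_add_card_inter (I.image c) Φ
  unfold cappedColours at h
  have hinj : Set.InjOn c I := Finset.card_image_iff.1 (by omega)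
  refine ⟨hinj, ?_⟩
  have h3 : (I.filter (c · ∈ Φ)).card = ((I.filter (c · ∈ Φ)).image c).card :=
    (Finset.card_image_of_injOn (hinj.mono fun e he =>
      (Finset.mem_filter.1 (Finset.mem_coe.1 he)).1)).symm
  have h4 : (I.filter (c · ∈ Φ)).image c ⊆ I.image c ∩ Φ := by
    intro k hk
    obtain ⟨e, he, rfl⟩ := Finset.mem_image.1 hk
    have he' := Finset.mem_filter.1 he
    exact Finset.mem_inter.2 ⟨Finset.mem_image_of_mem _ he'.1, he'.2⟩
  have h5 := Finset.card_le_card h4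
  omega

/-- Rado-type criterion for a rainbow spanning tree that uses at most `d` edges with colour in
`Φ`, when the vertices outside `L` are attached by a matching with private colours. -/
lemma exists_rainbow_spanning {V : Type u} [Fintype V] {c : Sym2 V → ℕ} {L W : Finset V}
    (hLW : ∀ v, v ∈ L ∨ v ∈ W) {y : V → V} (hyL : ∀ w ∈ W, y w ∈ L)
    {E M : Finset (Sym2 V)} (hM : M = W.image fun w => s(w, y w)) {Φ : Finset ℕ} {d : ℕ}
    (hMi : Set.InjOn c M) (hMΦ : ∀ e ∈ M, c e ∉ Φ) (hME : ∀ e ∈ M, ∀ f ∈ E, c f ≠ c e)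
    (hX : ∀ (K : Type u) [Fintype K] (π : V → K), (∀ κ, ∃ v ∈ L, π v = κ) →
      (∀ w ∈ W, π (y w) = π w) → Fintype.card K ≤ cappedColours c Φ d (crossing π E) + 1) :
    ∃ T ⊆ E ∪ M, T.card = Fintype.card V - 1 ∧ graphRank T = Fintype.card V - 1 ∧
      Set.InjOn c T ∧ (T.filter (c · ∈ Φ)).card ≤ d := by
  have key : ∀ A ⊆ E ∪ M, Fintype.card V - 1 ≤
      graphRank A + cappedColours c Φ d ((E ∪ M) \ A) := by
    intro A hA
    set G := SimpleGraph.fromEdgeSet ((A ∪ M : Finset (Sym2 V)) : Set (Sym2 V)) with hG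
    have hsame : ∀ u v, s(u, v) ∈ A ∪ M → G.connectedComponentMk u = G.connectedComponentMk v := by
      intro u v h
      by_cases huv : u = v
      · rw [huv]
      · refine SimpleGraph.ConnectedComponent.sound (SimpleGraph.Adj.reachable ?_)
        rw [hG, SimpleGraph.fromEdgeSet_adj]
        exact ⟨Finset.mem_coe.2 h, huv⟩
    have hyπ : ∀ w ∈ W, G.connectedComponentMk (y w) = G.connectedComponentMk w := fun w hw =>
      (hsame w (y w) (Finset.mem_union_right _ (by
        rw [hM]; exact Finset.mem_image_of_mem _ hw))).symm
    have h1 := hX G.ConnectedComponent G.connectedComponentMk (by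
      intro κ
      obtain ⟨v, rfl⟩ := Quot.exists_rep κ
      rcases hLW v with hv | hv
      · exact ⟨v, hv, rfl⟩
      · exact ⟨y v, hyL v hv, hyπ v hv⟩) hyπ
    have h2 := finrank_constOn (A ∪ M)
    have h3 : graphRank (A ∪ M) ≤ graphRank A + (M \ A).card := by
      have := (isRank_graphRank (V := V)).union_le_add_card A (M \ A)
      rwa [Finset.union_sdiff_self_eq_union] at this
    have h4 : crossing G.connectedComponentMk E ∪ M \ A ⊆ (E ∪ M) \ A := by
      intro e he
      rcases Finset.mem_union.1 he with he | he
      · refine Finset.mem_sdiff.2 ⟨Finset.mem_union_left _ (crossing_subset he), fun hA => ?_⟩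
        induction e with
        | _ a b => exact (mem_crossing.1 he).2 (hsame a b (Finset.mem_union_left _ hA))
      · have he' := Finset.mem_sdiff.1 he
        exact Finset.mem_sdiff.2 ⟨Finset.mem_union_right _ he'.1, he'.2⟩
    have h5 := (isRank_cappedColours c Φ d).mono h4
    have h6 : cappedColours c Φ d (crossing G.connectedComponentMk E) + (M \ A).card
        ≤ cappedColours c Φ d (crossing G.connectedComponentMk E ∪ M \ A) := by
      set X := crossing G.connectedComponentMk E with hX
      have hXE : X ⊆ E := crossing_subset
      have h7 : X.image c \ Φ ∪ (M \ A).image c ⊆ (X ∪ M \ A).image c \ Φ := by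
        intro k hk
        rcases Finset.mem_union.1 hk with hk | hk
        · have hk' := Finset.mem_sdiff.1 hk
          exact Finset.mem_sdiff.2
            ⟨Finset.image_subset_image Finset.subset_union_left hk'.1, hk'.2⟩
        · obtain ⟨e, he, rfl⟩ := Finset.mem_image.1 hk
          exact Finset.mem_sdiff.2 ⟨Finset.mem_image_of_mem _ (Finset.mem_union_right _ he),
            hMΦ e (Finset.mem_sdiff.1 he).1⟩
      have h8 : Disjoint (X.image c \ Φ) ((M \ A).image c) := by
        refine Finset.disjoint_left.2 fun k hk hk' => ?_
        obtain ⟨f, hf, rfl⟩ := Finset.mem_image.1 (Finset.mem_sdiff.1 hk).1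
        obtain ⟨e, he, h⟩ := Finset.mem_image.1 hk'
        exact hME e (Finset.mem_sdiff.1 he).1 f (hXE hf) h.symm
      have h9 : ((M \ A).image c).card = (M \ A).card :=
        Finset.card_image_of_injOn (hMi.mono (by
          intro e he
          exact (Finset.mem_sdiff.1 (Finset.mem_coe.1 he)).1))
      have h10 := Finset.card_le_card h7
      rw [Finset.card_union_of_disjoint h8, h9] at h10
      have h11 : (X.image c ∩ Φ).card ≤ ((X ∪ M \ A).image c ∩ Φ).card :=
        Finset.card_le_card (Finset.inter_subset_inter
          (Finset.image_subset_image Finset.subset_union_left) le_rfl)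
      unfold cappedColours
      omega
    have h12 : graphRank (A ∪ M) = Fintype.card V - Fintype.card G.ConnectedComponent := by
      unfold graphRank
      rw [h2]
    have h13 : Fintype.card G.ConnectedComponent ≤
      cappedColours c Φ d (crossing G.connectedComponentMk E) + 1 := h1
    omega
  obtain ⟨T, hT, hc, hr, hr'⟩ := exists_common_independent (E ∪ M) isRank_graphRank
    (isRank_cappedColours c Φ d) _ key
  exact ⟨T, hT, hc, hr, rainbow_of_cappedColours_eq_card (hr'.trans hc.symm)⟩

lemma exists_injective_choice {α β : Type*} [Nonempty β] (N : α → Finset β) (q : α → β → ℕ)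
    (m : ℕ) (W : Finset α) (hW : W.card ≤ m) (hq : ∀ w ∈ W, Set.InjOn (q w) (N w))
    (hN : ∀ w ∈ W, 2 * m ≤ (N w).card) :
    ∃ y : α → β, (∀ w ∈ W, y w ∈ N w) ∧ Set.InjOn y W ∧ Set.InjOn (fun w => q w (y w)) W := by
  induction W using Finset.induction_on with
  | empty => exact ⟨fun _ => Classical.arbitrary β, by simp⟩
  | insert a W ha ih =>
    rw [Finset.card_insert_of_notMem ha] at hW
    obtain ⟨y, hy, hyi, hyq⟩ := ih (by omega) (fun w hw => hq w (Finset.mem_insert_of_mem hw))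
      (fun w hw => hN w (Finset.mem_insert_of_mem hw))
    have h1 : ((N a).filter fun b => q a b ∈ W.image fun w => q w (y w)).card ≤ W.card := by
      refine (Finset.card_le_card_of_injOn (q a) ?_ ?_).trans
        (Finset.card_image_le (s := W) (f := fun w => q w (y w)))
      · intro b hb
        exact (Finset.mem_filter.1 hb).2
      · exact (hq a (Finset.mem_insert_self _ _)).mono fun b hb =>
          (Finset.mem_filter.1 (Finset.mem_coe.1 hb)).1
    have h2 : (W.image y ∪ (N a).filter fun b => q a b ∈ W.image fun w => q w (y w)).card
        < (N a).card := by
      have h3 := Finset.card_union_le (W.image y)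
        ((N a).filter fun b => q a b ∈ W.image fun w => q w (y w))
      have h4 : (W.image y).card ≤ W.card := Finset.card_image_le
      have := hN a (Finset.mem_insert_self _ _)
      omega
    obtain ⟨b, hbN, hb⟩ := Finset.exists_mem_notMem_of_card_lt_card h2
    simp only [Finset.mem_union, Finset.mem_filter, not_or, not_and] at hb
    have hne : ∀ w ∈ W, w ≠ a := fun w hw h => ha (h ▸ hw)
    have hup : ∀ w ∈ W, Function.update y a b w = y w := fun w hw =>
      Function.update_of_ne (hne w hw) _ _
    refine ⟨Function.update y a b, ?_, ?_, ?_⟩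
    · intro w hw
      rcases Finset.mem_insert.1 hw with rfl | hw
      · rwa [Function.update_self]
      · rw [hup w hw]
        exact hy w hw
    · rw [Finset.coe_insert, Set.injOn_insert (by simpa using ha)]
      refine ⟨fun w hw w' hw' h => hyi hw hw' (by rwa [hup w hw, hup w' hw'] at h), ?_⟩
      rintro ⟨w, hw, h⟩
      rw [hup w hw, Function.update_self] at h
      exact hb.1 (Finset.mem_image.2 ⟨w, hw, h⟩)
    · rw [Finset.coe_insert, Set.injOn_insert (by simpa using ha)]
      refine ⟨fun w hw w' hw' h => hyq hw hw' (by
        simp only at h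
        rwa [hup w hw, hup w' hw'] at h), ?_⟩
      rintro ⟨w, hw, h⟩
      simp only at h
      rw [hup w hw, Function.update_self] at h
      exact hb.2 hbN (Finset.mem_image.2 ⟨w, hw, h⟩)

section Step

variable {V : Type*} [Fintype V]

lemma edgeDegree_le_card_neighbours (A : Finset (Sym2 V)) (v : V) :
    edgeDegree A v ≤ ((Finset.univ : Finset V).filter (fun u => s(v, u) ∈ A)).card := by
  have : A.filter (v ∈ ·) ⊆
      ((Finset.univ : Finset V).filter (fun u => s(v, u) ∈ A)).image (fun u => s(v, u)) := by
    intro e he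
    obtain ⟨he, u, rfl⟩ := Finset.mem_filter.1 he
    exact Finset.mem_image.2 ⟨u, by simpa using he, rfl⟩
  exact (Finset.card_le_card this).trans Finset.card_image_le

/-- The colour class of `κ` in the complete graph. -/
noncomputable def colourClass (c : Sym2 V → ℕ) (κ : ℕ) : Finset (Sym2 V) :=
  Finset.univ.filter fun e => ¬ e.IsDiag ∧ c e = κ

/-- The edges of the complete graph with colour in `Φ`. -/
noncomputable def edgesColoured (c : Sym2 V → ℕ) (Φ : Finset ℕ) : Finset (Sym2 V) :=
  Finset.univ.filter fun e => ¬ e.IsDiag ∧ c e ∈ Φ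

/-- The colours split into the frequent colours `S` and the infrequent ones, of which `Φ` is a
selection; `R` is a reservoir of edges, almost regular and spread over the colours. -/
structure Reservoir (c : Sym2 V → ℕ) (x : ℝ) (S Φ : Finset ℕ) (R : Finset (Sym2 V))
    (d g : ℕ) : Prop where
  proper : ProperColoring (⊤ : SimpleGraph V) c
  pos : 0 < x
  two_mul_le : 2 * x ≤ Fintype.card V
  deficit_le : 150 * d ≤ x
  card_le : Fintype.card V ≤ S.card + d + 1
  le_card : ∀ κ ∈ S, x / 5 ≤ ((colourClass c κ).card : ℝ)
  card_poor_le : ∀ κ ∈ Φ, ((colourClass c κ).card : ℝ) ≤ x / 5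
  disjoint : Disjoint S Φ
  le_card_edgesColoured : (Fintype.card V : ℝ) * d ≤ 4 * (edgesColoured c Φ).card
  card_edgesColoured_le : 20 * ((edgesColoured c Φ).card : ℝ) ≤ 9 * (Fintype.card V : ℝ) * d
  not_isDiag : ∀ e ∈ R, ¬ e.IsDiag
  le_degree : ∀ v, g ≤ edgeDegree R v
  degree_le : ∀ v, edgeDegree R v ≤ 9 * g
  card_colour_le : ∀ κ, (R.filter (c · = κ)).card ≤ 4 * g
  card_poor_edges_le : 100 * ((R.filter (c · ∈ Φ)).card : ℝ) ≤ (Fintype.card V : ℝ) * d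
  mul_le : 1000 * g ≤ x
  lt_mul : x < 1000 * (g + 1)

/-- `U` is small enough to leave room for another tree after the removal of `τ` trees. -/
structure Sparse (c : Sym2 V → ℕ) (Φ : Finset ℕ) (R : Finset (Sym2 V)) (d τ : ℕ)
    (U : Finset (Sym2 V)) : Prop where
  not_isDiag : ∀ e ∈ U, ¬ e.IsDiag
  card_le : U.card ≤ τ * Fintype.card V
  colour_le : ∀ κ, (U.filter (c · = κ)).card ≤ τ
  degree_le : ∀ v, edgeDegree (R ∩ U) v ≤ τ
  poor_le : ((U \ R).filter (c · ∈ Φ)).card ≤ τ * d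

lemma Reservoir.exists_matching {c : Sym2 V → ℕ} {x : ℝ} {S Φ : Finset ℕ}
    {R : Finset (Sym2 V)} {d g : ℕ} (hR : Reservoir c x S Φ R d g) {τ : ℕ}
    {U : Finset (Sym2 V)} (hU : Sparse c Φ R d τ U)
    (hτ : 10 ^ 6 * τ * (Fintype.card V : ℝ) < x ^ 2) :
    ∃ W : Finset V, 5000 * (W.card : ℝ) ≤ x ∧ (∀ v ∉ W, 100 * (edgeDegree U v : ℝ) < x) ∧
      ∃ y : V → V, (∀ w ∈ W, y w ∉ W ∧ s(w, y w) ∈ R ∧ s(w, y w) ∉ U) ∧ Set.InjOn y W ∧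
        Set.InjOn (fun w => c s(w, y w)) W := by
  set W := (Finset.univ : Finset V).filter fun v => x ≤ 100 * (edgeDegree U v : ℝ) with hW
  have hpos := hR.pos
  have h2x := hR.two_mul_le
  have hWx : (W.card : ℝ) * x ≤ 200 * (τ * Fintype.card V) := by
    have h1 : ∑ v ∈ W, x ≤ ∑ v ∈ W, 100 * (edgeDegree U v : ℝ) :=
      Finset.sum_le_sum fun v hv => (Finset.mem_filter.1 hv).2
    have h2 : ∑ v ∈ W, 100 * (edgeDegree U v : ℝ) ≤ ∑ v, 100 * (edgeDegree U v : ℝ) :=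
      Finset.sum_le_sum_of_subset_of_nonneg (Finset.subset_univ _) fun _ _ _ => by positivity
    have h3 : ∑ v, 100 * (edgeDegree U v : ℝ) = 100 * (2 * U.card) := by
      rw [← Finset.mul_sum]
      exact_mod_cast congrArg (fun t => 100 * t) (sum_edgeDegree hU.not_isDiag)
    have h4 : (U.card : ℝ) ≤ τ * Fintype.card V := by exact_mod_cast hU.card_le
    rw [Finset.sum_const, nsmul_eq_mul] at h1
    linarith
  have hWx' : 5000 * (W.card : ℝ) ≤ x := by
    refine le_of_mul_le_mul_right ?_ hpos
    nlinarith
  refine ⟨W, hWx', fun v hv => ?_, ?_⟩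
  · simpa [hW] using hv
  rcases W.eq_empty_or_nonempty with hWe | ⟨w₀, hw₀⟩
  · rw [hWe]
    exact ⟨id, by simp⟩
  have hn0 : (0 : ℝ) < Fintype.card V := by linarith
  have hW1 : (1 : ℝ) ≤ W.card := by
    exact_mod_cast Finset.card_pos.2 ⟨w₀, hw₀⟩
  have hτ1 : (1 : ℝ) ≤ τ := by
    rcases Nat.eq_zero_or_pos τ with h | h
    · rw [h] at hWx
      simp only [Nat.cast_zero, zero_mul, mul_zero] at hWx
      nlinarith
    · exact_mod_cast h
  have hxbig : 2 * 10 ^ 6 * (τ : ℝ) < x := by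
    refine lt_of_mul_lt_mul_right ?_ hpos.le
    have : (τ : ℝ) * (2 * x) ≤ τ * Fintype.card V :=
      mul_le_mul_of_nonneg_left h2x (by linarith)
    nlinarith
  have hgw : 3 * W.card + τ ≤ g := by
    have := hR.lt_mul
    have : (3 * W.card + τ : ℝ) ≤ g := by linarith
    exact_mod_cast this
  have : Nonempty V := ⟨w₀⟩
  obtain ⟨y, hy, hyi, hyc⟩ := exists_injective_choice
    (fun w => (Finset.univ : Finset V).filter fun v => v ∉ W ∧ s(w, v) ∈ R ∧ s(w, v) ∉ U)
    (fun w v => c s(w, v)) W.card W le_rfl (by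
      intro w _ v hv v' hv' h
      have hv := (Finset.mem_filter.1 (Finset.mem_coe.1 hv)).2.2.1
      have hv' := (Finset.mem_filter.1 (Finset.mem_coe.1 hv')).2.2.1
      exact Sym2.congr_right.1 (hR.proper.eq_of_mem (hR.not_isDiag _ hv) (hR.not_isDiag _ hv') h
        (v := w) (by simp) (by simp))) (by
      intro w _
      have h1 : (Finset.univ : Finset V).filter (fun v => s(w, v) ∈ R) ⊆
          (Finset.univ : Finset V).filter (fun v => v ∉ W ∧ s(w, v) ∈ R ∧ s(w, v) ∉ U) ∪
          (W ∪ (Finset.univ : Finset V).filter fun v => s(w, v) ∈ R ∩ U) := by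
        intro v hv
        simp only [Finset.mem_union, Finset.mem_filter, Finset.mem_univ, true_and,
          Finset.mem_inter] at hv ⊢
        tauto
      have h2 := Finset.card_le_card h1
      have h3 := Finset.card_union_le
        ((Finset.univ : Finset V).filter (fun v => v ∉ W ∧ s(w, v) ∈ R ∧ s(w, v) ∉ U))
        (W ∪ (Finset.univ : Finset V).filter fun v => s(w, v) ∈ R ∩ U)
      have h4 := Finset.card_union_le W ((Finset.univ : Finset V).filter fun v => s(w, v) ∈ R ∩ U)
      have h5 := (card_neighbours_le (R ∩ U) w).trans (hU.degree_le w)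
      have h6 := (hR.le_degree w).trans (edgeDegree_le_card_neighbours R w)
      omega)
  exact ⟨y, fun w hw => (Finset.mem_filter.1 (hy w hw)).2, hyi, hyc⟩

end Step

section Tree

variable {V : Type*} [Fintype V]

lemma mem_colourClass {c : Sym2 V → ℕ} {κ : ℕ} {e : Sym2 V} :
    e ∈ colourClass c κ ↔ ¬ e.IsDiag ∧ c e = κ := by simp [colourClass]

lemma mem_edgesColoured {c : Sym2 V → ℕ} {Φ : Finset ℕ} {e : Sym2 V} :
    e ∈ edgesColoured c Φ ↔ ¬ e.IsDiag ∧ c e ∈ Φ := by simp [edgesColoured]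

/-- The edges available for a tree: those avoiding `U`, `R` and the colours in `C`, and lying
in `L` or having colour in `Φ`. -/
noncomputable def available (c : Sym2 V → ℕ) (Φ C : Finset ℕ) (R U : Finset (Sym2 V))
    (L : Finset V) : Finset (Sym2 V) :=
  Finset.univ.filter fun e => ¬ e.IsDiag ∧ e ∉ U ∧ e ∉ R ∧ c e ∉ C ∧ ((∀ v ∈ e, v ∈ L) ∨ c e ∈ Φ)

lemma mem_available {c : Sym2 V → ℕ} {Φ C : Finset ℕ} {R U : Finset (Sym2 V)} {L : Finset V}
    {e : Sym2 V} : e ∈ available c Φ C R U L ↔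
      ¬ e.IsDiag ∧ e ∉ U ∧ e ∉ R ∧ c e ∉ C ∧ ((∀ v ∈ e, v ∈ L) ∨ c e ∈ Φ) := by
  simp [available]

lemma card_missing_le {c : Sym2 V → ℕ} (hc : ProperColoring (⊤ : SimpleGraph V) c)
    {Φ C : Finset ℕ} {R U : Finset (Sym2 V)} {L : Finset V} {u : V} (hu : u ∈ L) :
    (L.filter fun v => v ≠ u ∧ s(u, v) ∉ available c Φ C R U L).card
      ≤ edgeDegree U u + edgeDegree R u + C.card := by
  have h1 : (L.filter fun v => v ≠ u ∧ s(u, v) ∉ available c Φ C R U L) ⊆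
      (Finset.univ.filter (fun v => s(u, v) ∈ U) ∪ Finset.univ.filter (fun v => s(u, v) ∈ R)) ∪
        Finset.univ.filter (fun v => v ≠ u ∧ c s(u, v) ∈ C) := by
    intro v hv
    obtain ⟨hvL, hne, hv⟩ := Finset.mem_filter.1 hv
    have hd : ¬ s(u, v).IsDiag := by simpa using hne.symm
    have hL : ∀ w ∈ s(u, v), w ∈ L := by
      intro w hw
      rcases Sym2.mem_iff.1 hw with rfl | rfl
      · exact hu
      · exact hvL
    rw [mem_available] at hv
    simp only [Finset.mem_union, Finset.mem_filter, Finset.mem_univ, true_and]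
    tauto
  have h2 := Finset.card_le_card h1
  have h3 := Finset.card_union_le
    (Finset.univ.filter (fun v => s(u, v) ∈ U) ∪ Finset.univ.filter (fun v => s(u, v) ∈ R))
    (Finset.univ.filter (fun v => v ≠ u ∧ c s(u, v) ∈ C))
  have h4 := Finset.card_union_le
    (Finset.univ.filter (fun v => s(u, v) ∈ U)) (Finset.univ.filter (fun v => s(u, v) ∈ R))
  have h5 := card_neighbours_le U u
  have h6 := card_neighbours_le R u
  have h7 := card_colour_at_le hc C u
  omega

lemma card_colourClass_le {c : Sym2 V → ℕ} (hc : ProperColoring (⊤ : SimpleGraph V) c)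
    {Φ C : Finset ℕ} {R U : Finset (Sym2 V)} {L W : Finset V} (hLW : ∀ v, v ∈ L ∨ v ∈ W)
    {κ : ℕ} (hκ : κ ∉ C) :
    (colourClass c κ).card ≤
      ((available c Φ C R U L).filter fun e => c e = κ ∧ ∀ v ∈ e, v ∈ L).card
        + (U.filter (c · = κ)).card + (R.filter (c · = κ)).card + W.card := by
  have h1 : colourClass c κ ⊆
      (((available c Φ C R U L).filter fun e => c e = κ ∧ ∀ v ∈ e, v ∈ L) ∪
        U.filter (c · = κ)) ∪ R.filter (c · = κ) ∪
          (colourClass c κ).filter (fun e => ∃ v ∈ W, v ∈ e) := by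
    intro e he
    have he' := he
    obtain ⟨hd, rfl⟩ := mem_colourClass.1 he'
    simp only [Finset.mem_union, Finset.mem_filter, mem_available]
    by_cases hW : ∃ v ∈ W, v ∈ e
    · exact .inr ⟨he, hW⟩
    · have hL : ∀ v ∈ e, v ∈ L := fun v hv => (hLW v).resolve_right fun h => hW ⟨v, h, hv⟩
      tauto
  have h2 := Finset.card_le_card h1
  have h3 := Finset.card_union_le
    ((((available c Φ C R U L).filter fun e => c e = κ ∧ ∀ v ∈ e, v ∈ L) ∪
        U.filter (c · = κ)) ∪ R.filter (c · = κ))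
    ((colourClass c κ).filter (fun e => ∃ v ∈ W, v ∈ e))
  have h4 := Finset.card_union_le
    (((available c Φ C R U L).filter fun e => c e = κ ∧ ∀ v ∈ e, v ∈ L) ∪
        U.filter (c · = κ)) (R.filter (c · = κ))
  have h5 := Finset.card_union_le
    ((available c Φ C R U L).filter fun e => c e = κ ∧ ∀ v ∈ e, v ∈ L) (U.filter (c · = κ))
  have h6 := hc.mul_card_le (X := (colourClass c κ).filter (fun e => ∃ v ∈ W, v ∈ e))
    (Z := W) (j := 1) (κ := κ)
    (fun e he => (mem_colourClass.1 (Finset.mem_filter.1 he).1).1)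
    (fun e he => (mem_colourClass.1 (Finset.mem_filter.1 he).1).2) (by
      intro e he
      obtain ⟨v, hv, hve⟩ := (Finset.mem_filter.1 he).2
      rw [Nat.succ_le_iff, Finset.card_pos]
      exact ⟨v, Finset.mem_filter.2 ⟨hv, hve⟩⟩)
  omega

lemma card_edgesColoured_le_available {c : Sym2 V → ℕ} {Φ C : Finset ℕ} {R U : Finset (Sym2 V)}
    {L : Finset V} {m : ℝ} (hm : ∀ κ ∈ Φ, ((colourClass c κ).card : ℝ) ≤ m) :
    ((edgesColoured c Φ).card : ℝ) ≤
      ((available c Φ C R U L).filter (c · ∈ Φ \ C)).card + ((U \ R).filter (c · ∈ Φ)).card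
        + (R.filter (c · ∈ Φ)).card + (Φ ∩ C).card * m := by
  have h1 : edgesColoured c Φ ⊆
      (((available c Φ C R U L).filter (c · ∈ Φ \ C)) ∪ (U \ R).filter (c · ∈ Φ)) ∪
        R.filter (c · ∈ Φ) ∪ edgesColoured c (Φ ∩ C) := by
    intro e he
    have := mem_edgesColoured.1 he
    simp only [Finset.mem_union, Finset.mem_filter, mem_available, mem_edgesColoured,
      Finset.mem_inter, Finset.mem_sdiff]
    tauto
  have h2 := Finset.card_le_card h1
  have h3 := Finset.card_union_le
    ((((available c Φ C R U L).filter (c · ∈ Φ \ C)) ∪ (U \ R).filter (c · ∈ Φ)) ∪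
        R.filter (c · ∈ Φ)) (edgesColoured c (Φ ∩ C))
  have h4 := Finset.card_union_le
    (((available c Φ C R U L).filter (c · ∈ Φ \ C)) ∪ (U \ R).filter (c · ∈ Φ))
        (R.filter (c · ∈ Φ))
  have h5 := Finset.card_union_le
    ((available c Φ C R U L).filter (c · ∈ Φ \ C)) ((U \ R).filter (c · ∈ Φ))
  have h6 : ((edgesColoured c (Φ ∩ C)).card : ℝ) ≤ (Φ ∩ C).card * m := by
    refine card_le_mul_colours (c := c) (fun e he => (mem_edgesColoured.1 he).2) ?_
    intro κ hκ
    refine le_trans ?_ (hm κ (Finset.mem_inter.1 hκ).1)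
    refine Nat.cast_le.2 (Finset.card_le_card fun e he => ?_)
    exact mem_colourClass.2 ⟨(mem_edgesColoured.1 (Finset.mem_filter.1 he).1).1,
      (Finset.mem_filter.1 he).2⟩
  have h7 : ((edgesColoured c Φ).card : ℝ) ≤
      ((available c Φ C R U L).filter (c · ∈ Φ \ C)).card + ((U \ R).filter (c · ∈ Φ)).card
        + (R.filter (c · ∈ Φ)).card + (edgesColoured c (Φ ∩ C)).card := by
    exact_mod_cast h2.trans (h3.trans (by omega))
  linarith

theorem Reservoir.exists_tree {c : Sym2 V → ℕ} {x : ℝ} {S Φ : Finset ℕ}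
    {R : Finset (Sym2 V)} {d g : ℕ} (hR : Reservoir c x S Φ R d g) {τ : ℕ}
    {U : Finset (Sym2 V)} (hU : Sparse c Φ R d τ U)
    (hτ : 10 ^ 6 * τ * (Fintype.card V : ℝ) < x ^ 2) :
    ∃ T : Finset (Sym2 V), (∀ e ∈ T, ¬ e.IsDiag) ∧ Disjoint T U ∧
      T.card = Fintype.card V - 1 ∧ graphRank T = Fintype.card V - 1 ∧ Set.InjOn c T ∧
      (∀ v, edgeDegree (R ∩ T) v ≤ 1) ∧ ((T \ R).filter (c · ∈ Φ)).card ≤ d := by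
  obtain ⟨W, hWx, hWd, y, hy, hyi, hyc⟩ := hR.exists_matching hU hτ
  have hpos := hR.pos
  have h2x := hR.two_mul_le
  have hc := hR.proper
  set L := Wᶜ with hL
  have hLW : ∀ v, v ∈ L ∨ v ∈ W := fun v => by
    rw [hL, Finset.mem_compl]; tauto
  have hyL : ∀ w ∈ W, y w ∈ L := fun w hw => Finset.mem_compl.2 (hy w hw).1
  set M := W.image fun w => s(w, y w) with hM
  set C := M.image c with hC
  have hCW : C.card ≤ W.card := Finset.card_image_le.trans Finset.card_image_le
  set E := available c Φ C R U L with hE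
  have hEd : ∀ e ∈ E, ¬ e.IsDiag := fun e he => (mem_available.1 he).1
  have hMR : ∀ e ∈ M, e ∈ R ∧ e ∉ U := by
    intro e he
    obtain ⟨w, hw, rfl⟩ := Finset.mem_image.1 he
    exact (hy w hw).2
  have hcardL : Fintype.card V = L.card + W.card := by
    rw [hL, Finset.card_compl_add_card]
  have hτx : 10 ^ 6 * 2 * (τ : ℝ) ≤ x := by
    refine le_of_mul_le_mul_right ?_ hpos
    have : (τ : ℝ) * (2 * x) ≤ τ * Fintype.card V :=
      mul_le_mul_of_nonneg_left h2x (Nat.cast_nonneg _)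
    nlinarith
  have hgx := hR.mul_le
  have hmissing : ∀ u ∈ L, (L.filter fun v => v ≠ u ∧ s(u, v) ∉ E).card ≤ ⌊x / 50⌋₊ := by
    intro u hu
    refine Nat.le_floor ?_
    have h1 : ((L.filter fun v => v ≠ u ∧ s(u, v) ∉ E).card : ℝ)
        ≤ edgeDegree U u + 9 * g + W.card := by
      have h2 := card_missing_le hc (Φ := Φ) (C := C) (R := R) (U := U) hu
      have h3 := hR.degree_le u
      exact_mod_cast h2.trans (by omega)
    have h2 := hWd u (by simpa [hL] using hu)
    linarith
  have hD : 50 * (⌊x / 50⌋₊ : ℝ) ≤ x := by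
    have := Nat.floor_le (show 0 ≤ x / 50 by positivity)
    linarith
  have hS : ∀ κ ∈ S \ C, 19 / 100 * x ≤
      ((E.filter fun e => c e = κ ∧ ∀ v ∈ e, v ∈ L).card : ℝ) := by
    intro κ hκ
    obtain ⟨hκS, hκC⟩ := Finset.mem_sdiff.1 hκ
    have h1 := card_colourClass_le hc (Φ := Φ) (R := R) (U := U) hLW hκC
    rw [← hE] at h1
    have h2 := hU.colour_le κ
    have h3 := hR.card_colour_le κ
    have h4 := hR.le_card κ hκS
    have h5 : ((colourClass c κ).card : ℝ) ≤
        (E.filter fun e => c e = κ ∧ ∀ v ∈ e, v ∈ L).card + τ + 4 * g + W.card := by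
      exact_mod_cast h1.trans (by omega)
    linarith
  have hcardS : L.card + (Φ ∩ C).card ≤ (S \ C).card + d + 1 := by
    have h1 := hR.card_le
    have h2 := Finset.card_sdiff_add_card_inter S C
    have h3 : (S ∩ C).card + (Φ ∩ C).card ≤ C.card := by
      rw [← Finset.card_union_of_disjoint (hR.disjoint.mono Finset.inter_subset_left
        Finset.inter_subset_left)]
      exact Finset.card_le_card (Finset.union_subset Finset.inter_subset_right
        Finset.inter_subset_right)
    omega
  have hΦ : ∀ κ ∈ Φ \ C, ((E.filter (c · = κ)).card : ℝ) ≤ x / 5 := by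
    intro κ hκ
    refine le_trans (Nat.cast_le.2 (Finset.card_le_card fun e he => ?_))
      (hR.card_poor_le κ (Finset.mem_sdiff.1 hκ).1)
    exact mem_colourClass.2 ⟨hEd e (Finset.mem_filter.1 he).1, (Finset.mem_filter.1 he).2⟩
  have hΦlow : 239 / 1000 * Fintype.card V * d - x / 5 * (Φ ∩ C).card ≤
      ((E.filter (c · ∈ Φ \ C)).card : ℝ) := by
    have h1 := card_edgesColoured_le_available (C := C) (R := R) (U := U) (L := L) hR.card_poor_le
    rw [← hE] at h1
    have h2 := hR.le_card_edgesColoured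
    have h3 := hR.card_poor_edges_le
    have h4 : (((U \ R).filter (c · ∈ Φ)).card : ℝ) ≤ τ * d := by exact_mod_cast hU.poor_le
    have h5 : 10 ^ 6 * 4 * (τ : ℝ) * d ≤ Fintype.card V * d :=
      mul_le_mul_of_nonneg_right (by linarith) (Nat.cast_nonneg d)
    linarith
  have hΦup : 20 * ((E.filter (c · ∈ Φ \ C)).card : ℝ) ≤ 9 * (Fintype.card V : ℝ) * d := by
    refine le_trans ?_ hR.card_edgesColoured_le
    refine mul_le_mul_of_nonneg_left (Nat.cast_le.2 (Finset.card_le_card fun e he => ?_))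
      (by norm_num)
    have he' := Finset.mem_filter.1 he
    exact mem_edgesColoured.2 ⟨hEd e he'.1, (Finset.mem_sdiff.1 he'.2).1⟩
  have hMi : Set.InjOn c M := by
    intro e he f hf h
    obtain ⟨w, hw, rfl⟩ := Finset.mem_image.1 (Finset.mem_coe.1 he)
    obtain ⟨w', hw', rfl⟩ := Finset.mem_image.1 (Finset.mem_coe.1 hf)
    rw [hyc hw hw' h]
  obtain ⟨T, hT, hTc, hTr, hTi, hTd⟩ := exists_rainbow_spanning (c := c) (Φ := Φ \ C) (d := d)
    (E := E) hLW hyL hM hMi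
    (fun e he h => (Finset.mem_sdiff.1 h).2 (Finset.mem_image_of_mem c he))
    (fun e he f hf h => (mem_available.1 hf).2.2.2.1 (h ▸ Finset.mem_image_of_mem c he)) (by
      intro K _ π hπ hyπ
      by_cases h1 : (L.card : ℝ) - Fintype.card K < 19 / 100 * x
      · refine card_le_cappedColours_of_small hc hLW hπ hyL hyπ hyi hEd ?_
          (S := S \ C) (l := (Φ ∩ C).card) ?_ hpos h2x hR.deficit_le hS hcardS hΦ hΦlow h1
        · exact fun w hw h => (mem_available.1 h).2.2.1 (hy w hw).2.1
        · exact hR.disjoint.mono Finset.sdiff_subset Finset.sdiff_subset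
      · by_cases h2 : ∀ κ, 5 * (L.filter (π · = κ)).card ≤ 3 * L.card
        · exact card_le_cappedColours_of_balanced hc hπ hEd hpos h2x hR.deficit_le hD hWx
            hcardL hmissing hΦup (not_lt.1 h1) h2
        · push Not at h2
          obtain ⟨κ₀, hκ₀⟩ := h2
          exact card_le_cappedColours_of_big_part hc hπ hEd hpos h2x hR.deficit_le hD hWx
            hcardL hmissing hΦup hκ₀)
  have hTM : ∀ e ∈ T, e ∈ R → e ∈ M := fun e he heR =>
    (Finset.mem_union.1 (hT he)).resolve_left fun h => (mem_available.1 h).2.2.1 heR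
  refine ⟨T, ?_, ?_, hTc, hTr, hTi, ?_, ?_⟩
  · intro e he
    rcases Finset.mem_union.1 (hT he) with h | h
    · exact hEd e h
    · exact hR.not_isDiag e (hMR e h).1
  · refine Finset.disjoint_left.2 fun e he heU => ?_
    rcases Finset.mem_union.1 (hT he) with h | h
    · exact (mem_available.1 h).2.1 heU
    · exact (hMR e h).2 heU
  · intro v
    refine Finset.card_le_one.2 ?_
    intro e he f hf
    simp only [Finset.mem_filter, Finset.mem_inter] at he hf
    obtain ⟨w, hw, rfl⟩ := Finset.mem_image.1 (hTM e he.1.2 he.1.1)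
    obtain ⟨w', hw', rfl⟩ := Finset.mem_image.1 (hTM f hf.1.2 hf.1.1)
    rcases Sym2.mem_iff.1 he.2 with h | h <;> rcases Sym2.mem_iff.1 hf.2 with h' | h'
    · rw [← h, ← h']
    · exact absurd (h' ▸ h ▸ hw) (hy w' hw').1
    · exact absurd (h ▸ h' ▸ hw') (hy w hw).1
    · rw [hyi hw hw' (h.symm.trans h')]
  · refine (Finset.card_le_card fun e he => ?_).trans hTd
    obtain ⟨he, heΦ⟩ := Finset.mem_filter.1 he
    obtain ⟨heT, heR⟩ := Finset.mem_sdiff.1 he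
    refine Finset.mem_filter.2 ⟨heT, Finset.mem_sdiff.2 ⟨heΦ, ?_⟩⟩
    rcases Finset.mem_union.1 (hT heT) with h | h
    · exact (mem_available.1 h).2.2.2.1
    · exact absurd (hMR e h).1 heR

end Tree

section ReservoirConstruction

variable {V : Type*} [Fintype V]

lemma exists_subset_sum_mem_Icc {ι : Type*} (f : ι → ℝ) {t b : ℝ} (ht : 0 ≤ t)
    (P : Finset ι) (hb : ∀ i ∈ P, f i ≤ b) (hP : t ≤ ∑ i ∈ P, f i) (hb0 : 0 ≤ b) :
    ∃ Φ ⊆ P, t ≤ ∑ i ∈ Φ, f i ∧ ∑ i ∈ Φ, f i ≤ t + b := by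
  induction P using Finset.induction_on with
  | empty =>
    refine ⟨∅, le_rfl, hP, ?_⟩
    rw [Finset.sum_empty]
    linarith
  | insert a P ha ih =>
    by_cases h : t ≤ ∑ i ∈ P, f i
    · obtain ⟨Φ, hΦ, h1, h2⟩ := ih (fun i hi => hb i (Finset.mem_insert_of_mem hi)) h
      exact ⟨Φ, hΦ.trans (Finset.subset_insert _ _), h1, h2⟩
    · refine ⟨insert a P, le_rfl, hP, ?_⟩
      rw [Finset.sum_insert ha]
      linarith [hb a (Finset.mem_insert_self _ _)]

lemma card_edgesColoured (c : Sym2 V → ℕ) (Φ : Finset ℕ) :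
    (edgesColoured c Φ).card = ∑ κ ∈ Φ, (colourClass c κ).card := by
  rw [Finset.card_eq_sum_card_fiberwise (f := c) (t := Φ)
    fun e he => (mem_edgesColoured.1 (Finset.mem_coe.1 he)).2]
  refine Finset.sum_congr rfl fun κ hκ => congrArg Finset.card ?_
  ext e
  rw [Finset.mem_filter, mem_edgesColoured, mem_colourClass]
  constructor
  · exact fun h => ⟨h.1.1, h.2⟩
  · rintro ⟨h, rfl⟩
    exact ⟨⟨h, hκ⟩, rfl⟩

lemma mul_card_filter_le_sum {ι : Type*} (s : Finset ι) (f : ι → ℕ) (k : ℕ) :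
    k * (s.filter (k ≤ f ·)).card ≤ ∑ i ∈ s, f i := by
  calc k * (s.filter (k ≤ f ·)).card = ∑ i ∈ s.filter (k ≤ f ·), k := by simp [mul_comm]
    _ ≤ ∑ i ∈ s.filter (k ≤ f ·), f i :=
      Finset.sum_le_sum fun i hi => (Finset.mem_filter.1 hi).2
    _ ≤ ∑ i ∈ s, f i := Finset.sum_le_sum_of_subset (Finset.filter_subset _ _)

/-- One vertex `v` can be given `g` new edges of the reservoir. -/
lemma exists_reservoir_star {c : Sym2 V → ℕ} (hc : ProperColoring (⊤ : SimpleGraph V) c)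
    {Φ : Finset ℕ} {g : ℕ} (hg : 0 < g) (hgn : 2000 * g ≤ Fintype.card V)
    {R : Finset (Sym2 V)} (hRd : ∀ e ∈ R, ¬ e.IsDiag) (hRc : R.card ≤ g * Fintype.card V) {v : V}
    (hv : edgeDegree R v ≤ 8 * g) :
    ∃ A : Finset V, A.card = g ∧ ∀ u ∈ A, u ≠ v ∧ s(v, u) ∉ R ∧ edgeDegree R u < 8 * g ∧
      (R.filter (c · = c s(v, u))).card < 4 * g ∧
      (8 * edgeDegree (edgesColoured c Φ) v < Fintype.card V → c s(v, u) ∉ Φ) := by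
  set B := (R.image c).filter (fun κ => 4 * g ≤ (R.filter (c · = κ)).card) with hB
  have hBc : 4 * B.card ≤ Fintype.card V := by
    have h1 := mul_card_filter_le_sum (R.image c) (fun κ => (R.filter (c · = κ)).card) (4 * g)
    rw [← Finset.card_eq_sum_card_fiberwise
      fun e he => Finset.mem_coe.2 (Finset.mem_image_of_mem c he)] at h1
    refine Nat.le_of_mul_le_mul_left ?_ hg
    have h2 : 4 * g * B.card ≤ g * Fintype.card V := h1.trans hRc
    linarith
  set H := (Finset.univ : Finset V).filter (fun u => 8 * g ≤ edgeDegree R u) with hH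
  have hHc : 4 * H.card ≤ Fintype.card V := by
    have h1 := mul_card_filter_le_sum (Finset.univ : Finset V) (edgeDegree R) (8 * g)
    rw [sum_edgeDegree hRd] at h1
    refine Nat.le_of_mul_le_mul_left ?_ hg
    have h2 : 8 * g * H.card ≤ 2 * R.card := h1
    linarith
  set F := (Finset.univ : Finset V).filter (fun u => s(v, u) ∈ edgesColoured c Φ ∧
    8 * edgeDegree (edgesColoured c Φ) v < Fintype.card V) with hF
  have hFc : 8 * F.card ≤ Fintype.card V := by
    by_cases h : 8 * edgeDegree (edgesColoured c Φ) v < Fintype.card V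
    · have h1 := card_neighbours_le (edgesColoured c Φ) v
      have h2 : F.card ≤ ((Finset.univ : Finset V).filter
          (fun u => s(v, u) ∈ edgesColoured c Φ)).card :=
        Finset.card_le_card fun u hu => by
          rw [Finset.mem_filter] at hu ⊢
          exact ⟨hu.1, hu.2.1⟩
      omega
    · simp [hF, h]
  set N := (Finset.univ : Finset V).filter (fun u => u ≠ v ∧ s(v, u) ∉ R ∧
    edgeDegree R u < 8 * g ∧ (R.filter (c · = c s(v, u))).card < 4 * g ∧
      (8 * edgeDegree (edgesColoured c Φ) v < Fintype.card V → c s(v, u) ∉ Φ)) with hN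
  have hcover : (Finset.univ : Finset V) ⊆ N ∪ ({v} ∪ (Finset.univ.filter (fun u => s(v, u) ∈ R) ∪
      (H ∪ (Finset.univ.filter (fun u => u ≠ v ∧ c s(v, u) ∈ B) ∪ F)))) := by
    intro u _
    have hBu : 4 * g ≤ (R.filter (c · = c s(v, u))).card → c s(v, u) ∈ B := by
      intro h
      refine Finset.mem_filter.2 ⟨?_, h⟩
      obtain ⟨e, he⟩ := Finset.card_pos.1 (show 0 < (R.filter (c · = c s(v, u))).card by omega)
      have he' := Finset.mem_filter.1 he
      exact Finset.mem_image.2 ⟨e, he'⟩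
    simp only [Finset.mem_union, Finset.mem_singleton, hN, hH, hF, Finset.mem_filter,
      Finset.mem_univ, true_and, mem_edgesColoured, Sym2.mk_isDiag_iff]
    by_cases huv : u = v
    · exact .inr (.inl huv)
    · have huv' : ¬ v = u := fun h => huv h.symm
      by_cases h1 : edgeDegree R u < 8 * g <;>
      by_cases h2 : (R.filter (c · = c s(v, u))).card < 4 * g
      · tauto
      · have := hBu (not_lt.1 h2)
        tauto
      · have := not_lt.1 h1
        tauto
      · have := not_lt.1 h1
        tauto
  have h0 := Finset.card_le_card hcover
  have h1 := Finset.card_union_le N ({v} ∪ (Finset.univ.filter (fun u => s(v, u) ∈ R) ∪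
      (H ∪ (Finset.univ.filter (fun u => u ≠ v ∧ c s(v, u) ∈ B) ∪ F))))
  have h2 := Finset.card_union_le {v} (Finset.univ.filter (fun u => s(v, u) ∈ R) ∪
      (H ∪ (Finset.univ.filter (fun u => u ≠ v ∧ c s(v, u) ∈ B) ∪ F)))
  have h3 := Finset.card_union_le (Finset.univ.filter (fun u => s(v, u) ∈ R))
      (H ∪ (Finset.univ.filter (fun u => u ≠ v ∧ c s(v, u) ∈ B) ∪ F))
  have h4 := Finset.card_union_le H (Finset.univ.filter (fun u => u ≠ v ∧ c s(v, u) ∈ B) ∪ F)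
  have h5 := Finset.card_union_le (Finset.univ.filter (fun u => u ≠ v ∧ c s(v, u) ∈ B)) F
  have h6 := card_colour_at_le hc B v
  have h7 := card_neighbours_le R v
  rw [Finset.card_univ] at h0
  rw [Finset.card_singleton] at h2
  obtain ⟨A, hA, hAc⟩ := Finset.exists_subset_card_eq (show g ≤ N.card by omega)
  exact ⟨A, hAc, fun u hu => (Finset.mem_filter.1 (hA hu)).2⟩

lemma exists_reservoir_edges {c : Sym2 V → ℕ} (hc : ProperColoring (⊤ : SimpleGraph V) c)
    (Φ : Finset ℕ) {g : ℕ} (hg : 0 < g) (hgn : 2000 * g ≤ Fintype.card V) (P : Finset V) :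
    ∃ R : Finset (Sym2 V), (∀ e ∈ R, ¬ e.IsDiag) ∧ (∀ v ∈ P, g ≤ edgeDegree R v) ∧
      (∀ v ∉ P, edgeDegree R v ≤ 8 * g) ∧ (∀ v, edgeDegree R v ≤ 9 * g) ∧
      (∀ κ, (R.filter (c · = κ)).card ≤ 4 * g) ∧ R.card ≤ g * P.card ∧
      (R.filter (c · ∈ Φ)).card ≤ g * (P.filter fun v =>
        Fintype.card V ≤ 8 * edgeDegree (edgesColoured c Φ) v).card := by
  induction P using Finset.induction_on with
  | empty => exact ⟨∅, by simp [edgeDegree]⟩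
  | insert v P hvP ih =>
    obtain ⟨R, hRd, hRg, hR8, hR9, hR4, hRc, hRΦ⟩ := ih
    have hRn : R.card ≤ g * Fintype.card V :=
      hRc.trans (Nat.mul_le_mul_left g (Finset.card_le_univ P))
    obtain ⟨A, hAc, hA⟩ := exists_reservoir_star hc (Φ := Φ) hg hgn hRd hRn (hR8 v hvP)
    set N := A.image (fun u => s(v, u)) with hN
    have hNinj : Set.InjOn (fun u => s(v, u)) A := fun u _ u' _ h => Sym2.congr_right.1 h
    have hNc : N.card = g := by rw [hN, Finset.card_image_of_injOn hNinj, hAc]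
    have hNd : ∀ e ∈ N, ¬ e.IsDiag := by
      intro e he
      obtain ⟨u, hu, rfl⟩ := Finset.mem_image.1 he
      simpa using (hA u hu).1.symm
    have hNv : ∀ e ∈ N, v ∈ e := by
      intro e he
      obtain ⟨u, hu, rfl⟩ := Finset.mem_image.1 he
      simp
    have hdeg : ∀ w, edgeDegree (R ∪ N) w ≤ edgeDegree R w + (N.filter (w ∈ ·)).card := by
      intro w
      unfold edgeDegree
      rw [Finset.filter_union]
      exact Finset.card_union_le _ _
    have hdegv : edgeDegree (R ∪ N) v ≤ 9 * g := by
      have h1 := hdeg v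
      have h2 := hR8 v hvP
      have h3 : (N.filter (v ∈ ·)).card ≤ N.card := Finset.card_filter_le _ _
      omega
    have hdegw : ∀ w, w ≠ v → edgeDegree (R ∪ N) w ≤ max (edgeDegree R w) (8 * g) := by
      intro w hw
      have h1 := hdeg w
      have hmem : ∀ e ∈ N.filter (w ∈ ·), e = s(v, w) ∧ w ∈ A := by
        intro e he
        obtain ⟨he, hwe⟩ := Finset.mem_filter.1 he
        obtain ⟨u, hu, rfl⟩ := Finset.mem_image.1 he
        rcases Sym2.mem_iff.1 hwe with rfl | rfl
        · exact absurd rfl hw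
        · exact ⟨rfl, hu⟩
      by_cases hwA : w ∈ A
      · have h2 : (N.filter (w ∈ ·)).card ≤ 1 :=
          Finset.card_le_one.2 fun e he f hf => (hmem e he).1.trans (hmem f hf).1.symm
        have h3 := (hA w hwA).2.2.1
        exact le_max_of_le_right (by omega)
      · have h2 : N.filter (w ∈ ·) = ∅ :=
          Finset.eq_empty_of_forall_notMem fun e he => hwA (hmem e he).2
        rw [h2, Finset.card_empty] at h1
        exact le_max_of_le_left h1
    refine ⟨R ∪ N, ?_, ?_, ?_, ?_, ?_, ?_, ?_⟩
    · intro e he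
      rcases Finset.mem_union.1 he with he | he
      · exact hRd e he
      · exact hNd e he
    · intro w hw
      rcases Finset.mem_insert.1 hw with rfl | hw
      · rw [← hNc]
        exact Finset.card_le_card fun e he =>
          Finset.mem_filter.2 ⟨Finset.mem_union_right _ he, hNv e he⟩
      · exact (hRg w hw).trans (Finset.card_le_card
          (Finset.filter_subset_filter _ Finset.subset_union_left))
    · intro w hw
      rw [Finset.mem_insert, not_or] at hw
      exact (hdegw w hw.1).trans (max_le (hR8 w hw.2) le_rfl)
    · intro w
      by_cases hw : w = v
      · rw [hw]
        exact hdegv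
      · exact (hdegw w hw).trans (max_le (hR9 w) (by omega))
    · intro κ
      rw [Finset.filter_union]
      have h1 := Finset.card_union_le (R.filter (c · = κ)) (N.filter (c · = κ))
      have h2 : (N.filter (c · = κ)).card ≤ 1 := by
        refine Finset.card_le_one.2 fun e he f hf => ?_
        have he' := Finset.mem_filter.1 he
        have hf' := Finset.mem_filter.1 hf
        exact hc.eq_of_mem (hNd e he'.1) (hNd f hf'.1) (he'.2.trans hf'.2.symm) (hNv e he'.1)
          (hNv f hf'.1)
      rcases (N.filter (c · = κ)).eq_empty_or_nonempty with h3 | ⟨e, he⟩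
      · rw [h3] at h1 ⊢
        have := hR4 κ
        rw [Finset.card_empty] at h1
        omega
      · obtain ⟨heN, rfl⟩ := Finset.mem_filter.1 he
        obtain ⟨u, hu, rfl⟩ := Finset.mem_image.1 heN
        have := (hA u hu).2.2.2.1
        omega
    · rw [Finset.card_insert_of_notMem hvP]
      have := Finset.card_union_le R N
      rw [mul_add, mul_one]
      omega
    · rw [Finset.filter_union, Finset.filter_insert]
      have h1 := Finset.card_union_le (R.filter (c · ∈ Φ)) (N.filter (c · ∈ Φ))
      split_ifs with hv
      · rw [Finset.card_insert_of_notMem (by simp [hvP]), mul_add, mul_one]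
        have h2 : (N.filter (c · ∈ Φ)).card ≤ N.card := Finset.card_filter_le _ _
        omega
      · have h2 : N.filter (c · ∈ Φ) = ∅ := by
          refine Finset.eq_empty_of_forall_notMem fun e he => ?_
          obtain ⟨heN, heΦ⟩ := Finset.mem_filter.1 he
          obtain ⟨u, hu, rfl⟩ := Finset.mem_image.1 heN
          exact (hA u hu).2.2.2.2 (not_le.1 hv) heΦ
        rw [h2, Finset.union_empty]
        exact hRΦ

theorem exists_reservoir {c : Sym2 V → ℕ} (hc : ProperColoring (⊤ : SimpleGraph V) c)
    {x : ℝ} (hx : 0 < x) (hn : 2 * x ≤ Fintype.card V) (S₀ : Finset ℕ)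
    (hS₀ : ∀ κ ∈ S₀, x ≤ ((colourClass c κ).card : ℝ))
    (hcard : (Fintype.card V : ℝ) - x / 150 ≤ S₀.card) :
    ∃ S Φ R d g, Reservoir c x S Φ R d g := by
  set I := (Finset.univ.filter fun e : Sym2 V => ¬ e.IsDiag).image c with hI
  set S := I.filter (fun κ => x / 5 ≤ ((colourClass c κ).card : ℝ)) with hS
  set P := I.filter (fun κ => ¬ x / 5 ≤ ((colourClass c κ).card : ℝ)) with hP
  have hS₀S : S₀ ⊆ S := by
    intro κ hκ
    have h1 := hS₀ κ hκ
    refine Finset.mem_filter.2 ⟨?_, by linarith⟩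
    have : 0 < (colourClass c κ).card := by
      have : (0 : ℝ) < (colourClass c κ).card := by linarith
      exact_mod_cast this
    obtain ⟨e, he⟩ := Finset.card_pos.1 this
    have he' := mem_colourClass.1 he
    exact Finset.mem_image.2 ⟨e, by simpa using he'.1, he'.2⟩
  have hS₀c := Finset.card_le_card hS₀S
  obtain ⟨d, hd⟩ : ∃ d, d = Fintype.card V - 1 - S.card := ⟨_, rfl⟩
  have hdx : 150 * (d : ℝ) ≤ x := by
    rcases Nat.eq_zero_or_pos d with h | h
    · rw [h]
      simpa using hx.le
    · have h1 : S₀.card + d + 1 ≤ Fintype.card V := by omega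
      have h2 : (S₀.card : ℝ) + d + 1 ≤ Fintype.card V := by exact_mod_cast h1
      linarith
  have hPb : ∀ κ ∈ P, ((colourClass c κ).card : ℝ) ≤ x / 5 := fun κ hκ =>
    (not_le.1 (Finset.mem_filter.1 hκ).2).le
  have htot : (Fintype.card V : ℝ) * d ≤ 2 * (edgesColoured c P).card := by
    have h1 : (edgesColoured c S).card + (edgesColoured c P).card =
        (Finset.univ.filter fun e : Sym2 V => ¬ e.IsDiag).card := by
      rw [card_edgesColoured, card_edgesColoured, Finset.sum_filter_add_sum_filter_not,
        ← card_edgesColoured]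
      refine congrArg Finset.card ?_
      ext e
      rw [mem_edgesColoured]
      simp only [Finset.mem_filter, Finset.mem_univ, true_and]
      exact ⟨fun h => h.1, fun h => ⟨h, Finset.mem_image_of_mem c (by simpa using h)⟩⟩
    have h2 : 2 * (edgesColoured c S).card ≤ S.card * Fintype.card V := by
      rw [card_edgesColoured, Finset.mul_sum]
      refine (Finset.sum_le_sum fun κ _ => hc.two_mul_card_le (κ := κ)
        (fun e he => (mem_colourClass.1 he).1) fun e he => (mem_colourClass.1 he).2).trans ?_
      simp
    have h3 : 2 * (Finset.univ.filter fun e : Sym2 V => ¬ e.IsDiag).card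
        = Fintype.card V * (Fintype.card V - 1) := by
      rw [← sum_edgeDegree (by simp), Finset.sum_congr rfl (g := fun _ => Fintype.card V - 1)]
      · simp
      · intro v _
        refine le_antisymm ?_ ?_
        · refine (edgeDegree_le_card_neighbours _ v).trans ?_
          rw [← Finset.card_univ, ← Finset.card_erase_of_mem (Finset.mem_univ v)]
          refine Finset.card_le_card fun u hu => ?_
          simp only [Finset.mem_filter, Finset.mem_univ, true_and, Sym2.mk_isDiag_iff] at hu
          exact Finset.mem_erase.2 ⟨fun h => hu h.symm, Finset.mem_univ _⟩
        · refine le_trans ?_ (card_neighbours_le _ v)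
          rw [← Finset.card_univ, ← Finset.card_erase_of_mem (Finset.mem_univ v)]
          refine Finset.card_le_card fun u hu => ?_
          simp only [Finset.mem_filter, Finset.mem_univ, true_and, Sym2.mk_isDiag_iff]
          exact fun h => (Finset.mem_erase.1 hu).1 h.symm
    rcases Nat.eq_zero_or_pos d with h | h
    · rw [h]
      simp
    · have h4 : Fintype.card V - 1 = S.card + d := by omega
      rw [h4] at h3
      have : Fintype.card V * d ≤ 2 * (edgesColoured c P).card := by nlinarith
      exact_mod_cast this
  obtain ⟨Φ, hΦP, hΦlow, hΦup⟩ : ∃ Φ ⊆ P,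
      (Fintype.card V : ℝ) * d ≤ 4 * (edgesColoured c Φ).card ∧
        20 * ((edgesColoured c Φ).card : ℝ) ≤ 9 * (Fintype.card V : ℝ) * d := by
    rcases Nat.eq_zero_or_pos d with h | h
    · refine ⟨∅, Finset.empty_subset _, ?_⟩
      rw [card_edgesColoured, h]
      simp
    · have h1 : (1 : ℝ) ≤ d := by exact_mod_cast h
      have h2 : (0 : ℝ) ≤ Fintype.card V * d := by positivity
      obtain ⟨Φ, hΦ, hl, hu⟩ := exists_subset_sum_mem_Icc
        (fun κ => ((colourClass c κ).card : ℝ)) (t := Fintype.card V * d / 4) (b := x / 5)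
        (by positivity) P hPb (by
          rw [card_edgesColoured] at htot
          push_cast at htot
          linarith) (by positivity)
      refine ⟨Φ, hΦ, ?_⟩
      rw [card_edgesColoured]
      push_cast
      refine ⟨by linarith, ?_⟩
      have h3 : (Fintype.card V : ℝ) * 1 ≤ Fintype.card V * d :=
        mul_le_mul_of_nonneg_left h1 (by positivity)
      linarith
  have hgx : 1000 * ((⌊x / 1000⌋₊ : ℕ) : ℝ) ≤ x := by
    have := Nat.floor_le (show 0 ≤ x / 1000 by positivity)
    linarith
  have hxg : x < 1000 * (((⌊x / 1000⌋₊ : ℕ) : ℝ) + 1) := by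
    have := Nat.lt_floor_add_one (x / 1000)
    linarith
  generalize ⌊x / 1000⌋₊ = g at hgx hxg
  obtain ⟨R, hRd, hRg, hR9, hR4, hRΦ⟩ : ∃ R : Finset (Sym2 V), (∀ e ∈ R, ¬ e.IsDiag) ∧
      (∀ v, g ≤ edgeDegree R v) ∧ (∀ v, edgeDegree R v ≤ 9 * g) ∧
      (∀ κ, (R.filter (c · = κ)).card ≤ 4 * g) ∧
      (R.filter (c · ∈ Φ)).card ≤ g * ((Finset.univ : Finset V).filter fun v =>
        Fintype.card V ≤ 8 * edgeDegree (edgesColoured c Φ) v).card := by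
    rcases Nat.eq_zero_or_pos g with h | h
    · subst h
      exact ⟨∅, by simp [edgeDegree]⟩
    · have h2 : 2000 * g ≤ Fintype.card V := by
        have : 2000 * (g : ℝ) ≤ Fintype.card V := by linarith
        exact_mod_cast this
      obtain ⟨R, h1, h2, -, h4, h5, -, h7⟩ := exists_reservoir_edges hc Φ h h2 Finset.univ
      exact ⟨R, h1, fun v => h2 v (Finset.mem_univ v), h4, h5, h7⟩
  refine ⟨S, Φ, R, d, g, hc, hx, hn, hdx, by omega, fun κ hκ => (Finset.mem_filter.1 hκ).2,
    fun κ hκ => hPb κ (hΦP hκ), ?_, hΦlow, hΦup, hRd, hRg, hR9, hR4, ?_, hgx, hxg⟩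
  · exact (Finset.disjoint_filter_filter_not _ _ _).mono_right hΦP
  · set Y := (Finset.univ : Finset V).filter fun v =>
        Fintype.card V ≤ 8 * edgeDegree (edgesColoured c Φ) v with hY
    have h1 : Fintype.card V * Y.card ≤ 16 * (edgesColoured c Φ).card := by
      have h2 := mul_card_filter_le_sum (Finset.univ : Finset V)
        (fun v => 8 * edgeDegree (edgesColoured c Φ) v) (Fintype.card V)
      rw [← Finset.mul_sum, sum_edgeDegree fun e he => (mem_edgesColoured.1 he).1] at h2
      have h3 : Fintype.card V * Y.card ≤ 8 * (2 * (edgesColoured c Φ).card) := h2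
      omega
    have h2 : (Fintype.card V : ℝ) * Y.card ≤ 16 * (edgesColoured c Φ).card := by
      exact_mod_cast h1
    have h3 : ((R.filter (c · ∈ Φ)).card : ℝ) ≤ g * Y.card := by exact_mod_cast hRΦ
    have h4 : 2000 * (g : ℝ) * Y.card ≤ Fintype.card V * Y.card :=
      mul_le_mul_of_nonneg_right (by linarith) (Nat.cast_nonneg _)
    linarith

end ReservoirConstruction

section Iteration

variable {V : Type*} [Fintype V]

lemma Sparse.union {c : Sym2 V → ℕ} {Φ : Finset ℕ} {R : Finset (Sym2 V)} {d τ : ℕ}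
    {U T : Finset (Sym2 V)} (hU : Sparse c Φ R d τ U) (hT : ∀ e ∈ T, ¬ e.IsDiag)
    (hTc : T.card = Fintype.card V - 1) (hTi : Set.InjOn c T)
    (hTR : ∀ v, edgeDegree (R ∩ T) v ≤ 1) (hTΦ : ((T \ R).filter (c · ∈ Φ)).card ≤ d) :
    Sparse c Φ R d (τ + 1) (U ∪ T) where
  not_isDiag e he := (Finset.mem_union.1 he).elim (hU.not_isDiag e) (hT e)
  card_le := by
    have h1 := Finset.card_union_le U T
    have h2 := hU.card_le
    rw [add_mul, one_mul]
    omega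
  colour_le κ := by
    rw [Finset.filter_union]
    refine (Finset.card_union_le _ _).trans (Nat.add_le_add (hU.colour_le κ) ?_)
    refine Finset.card_le_one.2 fun e he f hf => ?_
    have he' := Finset.mem_filter.1 he
    have hf' := Finset.mem_filter.1 hf
    exact hTi he'.1 hf'.1 (he'.2.trans hf'.2.symm)
  degree_le v := by
    unfold edgeDegree
    rw [Finset.inter_union_distrib_left, Finset.filter_union]
    exact (Finset.card_union_le _ _).trans (Nat.add_le_add (hU.degree_le v) (hTR v))
  poor_le := by
    rw [Finset.union_sdiff_distrib, Finset.filter_union, add_mul, one_mul]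
    exact (Finset.card_union_le _ _).trans (Nat.add_le_add hU.poor_le hTΦ)

theorem Reservoir.exists_trees {c : Sym2 V → ℕ} {x : ℝ} {S Φ : Finset ℕ}
    {R : Finset (Sym2 V)} {d g : ℕ} (hR : Reservoir c x S Φ R d g) (k : ℕ)
    (hk : ∀ τ < k, 10 ^ 6 * τ * (Fintype.card V : ℝ) < x ^ 2) :
    ∃ T : Fin k → Finset (Sym2 V), (∀ i, (∀ e ∈ T i, ¬ e.IsDiag) ∧
      (T i).card = Fintype.card V - 1 ∧ graphRank (T i) = Fintype.card V - 1 ∧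
      Set.InjOn c (T i)) ∧ (∀ i j, i ≠ j → Disjoint (T i) (T j)) ∧
      Sparse c Φ R d k (Finset.univ.biUnion T) := by
  induction k with
  | zero => exact ⟨Fin.elim0, fun i => i.elim0, fun i => i.elim0, by
      constructor <;> simp [edgeDegree]⟩
  | succ k ih =>
    obtain ⟨T, hT, hTd, hTs⟩ := ih fun τ h => hk τ (by omega)
    obtain ⟨T', h1, h2, h3, h4, h5, h6, h7⟩ := hR.exists_tree hTs (hk k (by omega))
    refine ⟨Fin.cons T' T, ?_, ?_, ?_⟩
    · intro i
      induction i using Fin.cases with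
      | zero => exact ⟨h1, h3, h4, h5⟩
      | succ i => exact hT i
    · have hdis : ∀ i, Disjoint T' (T i) := fun i =>
        h2.mono_right (Finset.subset_biUnion_of_mem T (Finset.mem_univ i))
      intro i j hij
      induction i using Fin.cases with
      | zero =>
        induction j using Fin.cases with
        | zero => exact absurd rfl hij
        | succ j => exact hdis j
      | succ i =>
        induction j using Fin.cases with
        | zero => exact (hdis i).symm
        | succ j => exact hTd i j fun h => hij (by rw [h])
    · have : Finset.univ.biUnion (Fin.cons T' T : Fin (k + 1) → Finset (Sym2 V)) =
          Finset.univ.biUnion T ∪ T' := by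
        ext e
        simp [Fin.exists_fin_succ, or_comm]
      rw [this]
      exact hTs.union h1 h3 h5 h6 h7

end Iteration

theorem stmt10 {V : Type*} [Fintype V] [DecidableEq V] (c : Sym2 V → ℕ)
    (α : ℝ) (hα : 0 < α) (hα' : α ≤ 1 / 2)
    (hproper : ProperColoring (⊤ : SimpleGraph V) c)
    (S : Finset ℕ) (hrich : ∀ k ∈ S, RichClass (⊤ : SimpleGraph V) c α {k})
    (hS : (Fintype.card V : ℝ) - α * (Fintype.card V : ℝ) / 150 ≤ (S.card : ℝ)) :
    ∃ (k : ℕ) (T : Fin k → SimpleGraph V),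
      α ^ 2 * (Fintype.card V : ℝ) / 10 ^ 6 ≤ (k : ℝ) ∧
      (∀ i, (T i).IsTree ∧ IsRainbow c (T i).edgeSet) ∧
      (∀ i j, i ≠ j → Disjoint ((T i).edgeSet) ((T j).edgeSet)) := by
  rcases isEmpty_or_nonempty V with hV | hV
  · exact ⟨0, Fin.elim0, by simp, fun i => i.elim0, fun i => i.elim0⟩
  have hn : (0 : ℝ) < Fintype.card V := by exact_mod_cast Fintype.card_pos
  have hx : 0 < α * (Fintype.card V : ℝ) := mul_pos hα hn
  obtain ⟨S', Φ, R, d, g, hR⟩ := exists_reservoir hproper hx (by nlinarith) S (by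
    intro κ hκ
    obtain ⟨M, hM, hMc, -, hle⟩ := hrich κ hκ
    refine hle.trans (Nat.cast_le.2 (Finset.card_le_card fun e he => ?_))
    refine mem_colourClass.2 ⟨?_, by simpa using hMc e he⟩
    simpa using hM (Finset.mem_coe.2 he)) hS
  obtain ⟨T, hT, hTd, -⟩ := hR.exists_trees ⌈α ^ 2 * (Fintype.card V : ℝ) / 10 ^ 6⌉₊ (by
    intro τ hτ
    have h1 := Nat.lt_ceil.1 hτ
    have h2 := mul_lt_mul_of_pos_right h1 hn
    nlinarith)
  have htree := fun i => isTree_of_graphRank (hT i).1 (hT i).2.1 (hT i).2.2.1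
  refine ⟨_, fun i => SimpleGraph.fromEdgeSet (T i : Set (Sym2 V)), Nat.le_ceil _, ?_, ?_⟩
  · intro i
    refine ⟨(htree i).1, ?_⟩
    rw [(htree i).2]
    exact (hT i).2.2.2
  · intro i j hij
    rw [(htree i).2, (htree j).2]
    exact Finset.disjoint_coe.2 (hTd i j hij)
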